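/- Fix 0 < c < 1 and let G_n ∈ G(n, c/n). Then the sequence of random variables (β(G_n) − E[β(G_n)]) / sqrt(Var[β(G_n)]) converges in distribution, as n → ∞, to a standard normal random variable. -/

import Mathlib

open scoped Classical BigOperators
open Filter Topology

noncomputable section

namespace MetricDimPaper

/-- `R` is a resolving set of `G`: every pair of distinct vertices is distinguished by its
vector of (extended, possibly infinite) distances to the vertices of `R`. -/
def Resolves {V : Type*} (G : SimpleGraph V) (R : Set V) : Prop :=
  ∀ u v : V, u ≠ v → ∃ w ∈ R, G.edist u w ≠ G.edist v w

/-- The metric dimension of a graph: the least cardinality of a resolving set, with the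
convention that a single isolated vertex has metric dimension 1. -/
def metricDim {V : Type*} (G : SimpleGraph V) : ℕ :=
  if Nat.card V = 1 then 1
  else sInf {m : ℕ | ∃ R : Set V, R.ncard = m ∧ Resolves G R}

/-- A tree: a connected acyclic graph. -/
def IsTree {V : Type*} (G : SimpleGraph V) : Prop := G.Connected ∧ G.IsAcyclic

/-- degree of a vertex (as `Nat.card` of the neighbor set). -/
def ndeg {V : Type*} (G : SimpleGraph V) (v : V) : ℕ := (G.neighborSet v).ncard

/-- metric dimension as a real number -/
def betaR {n : ℕ} (G : SimpleGraph (Fin n)) : ℝ := (metricDim G : ℝ)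

def treeSet (n : ℕ) : Set (SimpleGraph (Fin n)) := {G | IsTree G}

def forestSet (n : ℕ) : Set (SimpleGraph (Fin n)) := {G | G.IsAcyclic}

/-- Expectation of `f` under the uniform distribution on the (finite) set `S` of graphs. -/
def unifExp {n : ℕ} (S : Set (SimpleGraph (Fin n))) (f : SimpleGraph (Fin n) → ℝ) : ℝ :=
  (∑ᶠ G ∈ S, f G) / (Nat.card ↥S)

/-- Variance of `f` under the uniform distribution on `S`. -/
def unifVar {n : ℕ} (S : Set (SimpleGraph (Fin n))) (f : SimpleGraph (Fin n) → ℝ) : ℝ :=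
  unifExp S (fun G => (f G - unifExp S f) ^ 2)

/-- Probability of the event `A` under the uniform distribution on `S`. -/
def unifPr {n : ℕ} (S A : Set (SimpleGraph (Fin n))) : ℝ :=
  (Nat.card ↥(S ∩ A) : ℝ) / (Nat.card ↥S)

/-- The probability weight of an individual graph in the Erdős–Rényi model `G(n,p)`. -/
def erWeight (n : ℕ) (p : ℝ) (G : SimpleGraph (Fin n)) : ℝ :=
  p ^ (Nat.card ↥G.edgeSet) * (1 - p) ^ (n.choose 2 - Nat.card ↥G.edgeSet)

/-- Expectation of `f` in the Erdős–Rényi model `G(n,p)`. -/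
def erExp (n : ℕ) (p : ℝ) (f : SimpleGraph (Fin n) → ℝ) : ℝ :=
  ∑ᶠ G : SimpleGraph (Fin n), erWeight n p G * f G

/-- Variance of `f` in the Erdős–Rényi model `G(n,p)`. -/
def erVar (n : ℕ) (p : ℝ) (f : SimpleGraph (Fin n) → ℝ) : ℝ :=
  erExp n p (fun G => (f G - erExp n p f) ^ 2)

/-- Probability of the event `A` in the Erdős–Rényi model `G(n,p)`. -/
def erPr (n : ℕ) (p : ℝ) (A : Set (SimpleGraph (Fin n))) : ℝ :=
  ∑ᶠ G ∈ A, erWeight n p G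

/-- The cumulative distribution function of the standard normal law. -/
def stdGaussianCDF (x : ℝ) : ℝ :=
  (Real.sqrt (2 * Real.pi))⁻¹ * ∫ t in Set.Iic x, Real.exp (-(t ^ 2) / 2)

/-- The normalized metric dimension `(β - E β)/sqrt (Var β)` for the uniform model on `S`. -/
def normβ {n : ℕ} (S : Set (SimpleGraph (Fin n))) (G : SimpleGraph (Fin n)) : ℝ :=
  (betaR G - unifExp S betaR) / Real.sqrt (unifVar S betaR)

/-- The normalized metric dimension `(β - E β)/sqrt (Var β)` for the `G(n,p)` model. -/
def erNormβ (n : ℕ) (p : ℝ) (G : SimpleGraph (Fin n)) : ℝ :=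
  (betaR G - erExp n p betaR) / Real.sqrt (erVar n p betaR)

/-! ### Expectations in the Erdős–Rényi model and resampling -/

section Resampling

variable {n : ℕ} {p : ℝ} {E : Type*} [AddCommGroup E] [Module ℝ E]

/-- Expectation in `G(n,p)` of a function with values in a real vector space. -/
def ev (p : ℝ) (f : SimpleGraph (Fin n) → E) : E :=
  ∑ G : SimpleGraph (Fin n), erWeight n p G • f G

lemma erExp_eq_ev (f : SimpleGraph (Fin n) → ℝ) : erExp n p f = ev p f := by
  simp [erExp, ev, finsum_eq_sum_of_fintype]

lemma erWeight_eq_prod (G : SimpleGraph (Fin n)) :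
    erWeight n p G = (∏ _e ∈ G.edgeFinset, p) *
      ∏ _e ∈ (⊤ : SimpleGraph (Fin n)).edgeFinset \ G.edgeFinset, (1 - p) := by
  have hsub : G.edgeFinset ⊆ (⊤ : SimpleGraph (Fin n)).edgeFinset :=
    SimpleGraph.edgeFinset_mono le_top
  have hcard : (⊤ : SimpleGraph (Fin n)).edgeFinset.card = n.choose 2 := by
    rw [SimpleGraph.card_edgeFinset_top_eq_card_choose_two, Fintype.card_fin]
  rw [Finset.prod_const, Finset.prod_const, Finset.card_sdiff_of_subset hsub, hcard, erWeight,
    Nat.card_eq_fintype_card, SimpleGraph.edgeFinset_card]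

lemma erWeight_nonneg (hp0 : 0 ≤ p) (hp1 : p ≤ 1) (G : SimpleGraph (Fin n)) :
    0 ≤ erWeight n p G :=
  mul_nonneg (pow_nonneg hp0 _) (pow_nonneg (by linarith) _)

/-- The generating function of the number of edges inside a fixed set of pairs. -/
lemma ev_prod_edges (L : Finset (Sym2 (Fin n))) (hL : ∀ e ∈ L, ¬ e.IsDiag) (x : ℝ) :
    ev p (fun G => ∏ e ∈ L, if e ∈ G.edgeSet then x else 1) = (1 + p * (x - 1)) ^ L.card := by
  set T := (⊤ : SimpleGraph (Fin n)).edgeFinset with hT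
  have hLT : L ⊆ T := fun e he => by
    simpa [hT] using hL e he
  have key : ∏ e ∈ T, ((p * if e ∈ L then x else 1) + (1 - p)) = (1 + p * (x - 1)) ^ L.card := by
    rw [← Finset.prod_subset hLT]
    · rw [← Finset.prod_const]
      refine Finset.prod_congr rfl fun e he => ?_
      rw [if_pos he]; ring
    · intro e _ he
      rw [if_neg he]; ring
  rw [← key, Finset.prod_add, ev]
  refine Finset.sum_bij' (fun G _ => G.edgeFinset)
    (fun s _ => SimpleGraph.fromEdgeSet (s : Set (Sym2 (Fin n)))) ?_ ?_ ?_ ?_ ?_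
  · intro G _
    exact Finset.mem_powerset.2 (SimpleGraph.edgeFinset_mono le_top)
  · simp
  · intro G _
    simp
  · intro s hs
    ext e
    have : e ∈ s → ¬ e.IsDiag := fun he => by
      simpa [hT] using Finset.mem_powerset.1 hs he
    simp only [SimpleGraph.mem_edgeFinset, SimpleGraph.edgeSet_fromEdgeSet, Set.mem_sdiff,
      Finset.mem_coe, Sym2.mem_diagSet]
    tauto
  · intro G _
    rw [erWeight_eq_prod, Finset.prod_mul_distrib, smul_eq_mul]
    have : ∏ e ∈ L, (if e ∈ G.edgeSet then x else 1)
        = ∏ e ∈ G.edgeFinset, (if e ∈ L then x else 1) := by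
      rw [← Finset.prod_filter, ← Finset.prod_filter]
      refine Finset.prod_congr ?_ fun _ _ => rfl
      ext e
      simp [and_comm]
    rw [this]; ring

lemma sum_erWeight : ∑ G : SimpleGraph (Fin n), erWeight n p G = 1 := by
  simpa [ev] using ev_prod_edges (p := p) (n := n) ∅ (by simp) 1

@[simp] lemma ev_const (x : E) : ev (n := n) p (fun _ => x) = x := by
  rw [ev, ← Finset.sum_smul, sum_erWeight, one_smul]

lemma ev_add (f g : SimpleGraph (Fin n) → E) :
    ev p (fun G => f G + g G) = ev p f + ev p g := by
  simp [ev, Finset.sum_add_distrib]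

lemma ev_sub (f g : SimpleGraph (Fin n) → E) :
    ev p (fun G => f G - g G) = ev p f - ev p g := by
  simp [ev, smul_sub, Finset.sum_sub_distrib]

lemma ev_sum {ι : Type*} (s : Finset ι) (f : ι → SimpleGraph (Fin n) → E) :
    ev p (fun G => ∑ i ∈ s, f i G) = ∑ i ∈ s, ev p (f i) := by
  simp only [ev, Finset.smul_sum]
  exact Finset.sum_comm

lemma ev_mul_left {A : Type*} [Ring A] [Algebra ℝ A] (a : A) (f : SimpleGraph (Fin n) → A) :
    ev p (fun G => a * f G) = a * ev p f := by
  simp [ev, Finset.mul_sum]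

lemma ev_mul_right {A : Type*} [Ring A] [Algebra ℝ A] (a : A) (f : SimpleGraph (Fin n) → A) :
    ev p (fun G => f G * a) = ev p f * a := by
  simp [ev, Finset.sum_mul]

lemma ev_ofReal (f : SimpleGraph (Fin n) → ℝ) :
    ev p (fun G => (f G : ℂ)) = ((ev p f : ℝ) : ℂ) := by
  simp [ev]

lemma ev_mono (hp0 : 0 ≤ p) (hp1 : p ≤ 1) {f g : SimpleGraph (Fin n) → ℝ}
    (h : ∀ G, f G ≤ g G) : ev p f ≤ ev p g :=
  Finset.sum_le_sum fun G _ => mul_le_mul_of_nonneg_left (h G) (erWeight_nonneg hp0 hp1 G)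

lemma norm_ev_le {A : Type*} [NormedAddCommGroup A] [NormedSpace ℝ A] (hp0 : 0 ≤ p) (hp1 : p ≤ 1)
    {f : SimpleGraph (Fin n) → A} {g : SimpleGraph (Fin n) → ℝ} (h : ∀ G, ‖f G‖ ≤ g G) :
    ‖ev p f‖ ≤ ev p g := by
  refine norm_sum_le_of_le _ fun G _ => ?_
  rw [norm_smul, Real.norm_of_nonneg (erWeight_nonneg hp0 hp1 G)]
  exact mul_le_mul_of_nonneg_left (h G) (erWeight_nonneg hp0 hp1 G)

/-- The graph agreeing with `G'` on the pairs in `P` and with `G` elsewhere. -/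
def mix (P : Set (Sym2 (Fin n))) (G G' : SimpleGraph (Fin n)) : SimpleGraph (Fin n) where
  Adj u v := if s(u, v) ∈ P then G'.Adj u v else G.Adj u v
  symm := ⟨fun u v h => by
    rw [Sym2.eq_swap]; simpa only [G.adj_comm, G'.adj_comm] using h⟩
  loopless := ⟨fun u h => by split_ifs at h <;> simp at h⟩

lemma mix_adj (P : Set (Sym2 (Fin n))) (G G' : SimpleGraph (Fin n)) (u v : Fin n) :
    (mix P G G').Adj u v ↔ if s(u, v) ∈ P then G'.Adj u v else G.Adj u v := Iff.rfl

lemma mix_mix (P : Set (Sym2 (Fin n))) (G G' : SimpleGraph (Fin n)) :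
    mix P (mix P G G') (mix P G' G) = G := by
  ext u v
  simp only [mix_adj]
  split_ifs <;> rfl

lemma edgeFinset_mix (P : Set (Sym2 (Fin n))) (G G' : SimpleGraph (Fin n)) :
    (mix P G G').edgeFinset = (G.edgeFinset.filter (· ∉ P)) ∪ (G'.edgeFinset.filter (· ∈ P)) := by
  ext e
  induction e with
  | _ u v =>
    simp only [SimpleGraph.mem_edgeFinset, SimpleGraph.mem_edgeSet, mix_adj, Finset.mem_union,
      Finset.mem_filter]
    split_ifs with h <;> simp [h]

lemma card_edgeFinset_mix (P : Set (Sym2 (Fin n))) (G G' : SimpleGraph (Fin n)) :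
    (mix P G G').edgeFinset.card
      = (G.edgeFinset.filter (· ∉ P)).card + (G'.edgeFinset.filter (· ∈ P)).card := by
  rw [edgeFinset_mix, Finset.card_union_of_disjoint]
  exact Finset.disjoint_left.2 fun e h h' => (Finset.mem_filter.1 h).2 (Finset.mem_filter.1 h').2

lemma erWeight_mix (P : Set (Sym2 (Fin n))) (G G' : SimpleGraph (Fin n)) :
    erWeight n p (mix P G G') * erWeight n p (mix P G' G) = erWeight n p G * erWeight n p G' := by
  have hw : ∀ H : SimpleGraph (Fin n), erWeight n p H
      = p ^ H.edgeFinset.card * (1 - p) ^ (n.choose 2 - H.edgeFinset.card) := fun H => by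
    rw [erWeight, Nat.card_eq_fintype_card, SimpleGraph.edgeFinset_card]
  have hle : ∀ H : SimpleGraph (Fin n), H.edgeFinset.card ≤ n.choose 2 := fun H => by
    simpa using H.card_edgeFinset_le_card_choose_two
  have e1 := hle (mix P G G')
  have e2 := hle (mix P G' G)
  have e3 := hle G
  have e4 := hle G'
  have c1 := card_edgeFinset_mix P G G'
  have c2 := card_edgeFinset_mix P G' G
  have c3 := Finset.card_filter_add_card_filter_not (s := G.edgeFinset) (· ∈ P)
  have c4 := Finset.card_filter_add_card_filter_not (s := G'.edgeFinset) (· ∈ P)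
  have key : ∀ a b a' b' N : ℕ, a ≤ N → b ≤ N → a' ≤ N → b' ≤ N → a + b = a' + b' →
      p ^ a * (1 - p) ^ (N - a) * (p ^ b * (1 - p) ^ (N - b))
        = p ^ a' * (1 - p) ^ (N - a') * (p ^ b' * (1 - p) ^ (N - b')) := by
    intro a b a' b' N h1 h2 h3 h4 h5
    have l : ∀ a b : ℕ, p ^ a * (1 - p) ^ (N - a) * (p ^ b * (1 - p) ^ (N - b))
        = p ^ (a + b) * (1 - p) ^ ((N - a) + (N - b)) := fun a b => by ring
    rw [l, l, h5]
    congr 2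
    omega
  rw [hw, hw, hw, hw]
  exact key _ _ _ _ _ e1 e2 e3 e4 (by omega)

/-- Resampling: if the pairs in `P G` are never inspected in order to determine `P G`, then they
may be replaced by those of an independent copy. -/
lemma ev_decouple (P : SimpleGraph (Fin n) → Set (Sym2 (Fin n)))
    (hP : ∀ G G', P (mix (P G) G G') = P G)
    (k : SimpleGraph (Fin n) → SimpleGraph (Fin n) → E)
    (hk : ∀ G G', k (mix (P G) G G') (mix (P G) G' G) = k G G) :
    ev p (fun G => k G G) = ev p fun G => ev p fun G' => k G G' := by
  have h1 : ev p (fun G => k G G) = ev p fun G => ev p fun _ : SimpleGraph (Fin n) => k G G := by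
    simp
  have h2 : ∀ f : SimpleGraph (Fin n) → SimpleGraph (Fin n) → E,
      (ev p fun G => ev p fun G' => f G G')
        = ∑ x : SimpleGraph (Fin n) × SimpleGraph (Fin n),
            (erWeight n p x.1 * erWeight n p x.2) • f x.1 x.2 := fun f => by
    rw [Fintype.sum_prod_type]
    simp only [ev, Finset.smul_sum, smul_smul]
  rw [h1, h2, h2]
  let σ : SimpleGraph (Fin n) × SimpleGraph (Fin n) → SimpleGraph (Fin n) × SimpleGraph (Fin n) :=
    fun x => (mix (P x.1) x.1 x.2, mix (P x.1) x.2 x.1)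
  have hσ : Function.Involutive σ := fun x => by
    simp only [σ, hP, mix_mix]
  refine Fintype.sum_equiv hσ.toPerm _ _ fun x => ?_
  simp only [Function.Involutive.coe_toPerm, σ, hk, erWeight_mix]

lemma ev_mul_of_indep {A : Type*} [Ring A] [Algebra ℝ A] (P : Set (Sym2 (Fin n)))
    (f g : SimpleGraph (Fin n) → A) (hf : ∀ G G', f (mix P G G') = f G)
    (hg : ∀ G G', g (mix P G G') = g G') :
    ev p (fun G => f G * g G) = ev p f * ev p g := by
  rw [ev_decouple (fun _ => P) (fun _ _ => rfl) (fun G G' => f G * g G')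
    (fun G G' => by rw [hf, hg])]
  simp only [ev_mul_left, ev_mul_right]

end Resampling

/-! ### Closed vertex sets, restrictions and hulls -/

section Hull

variable {V : Type*}

/-- No edge of `G` leaves `S`. -/
def IsClosedIn (G : SimpleGraph V) (S : Finset V) : Prop :=
  ∀ u ∈ S, ∀ v, G.Adj u v → v ∈ S

/-- The graph on `V` obtained from `G` by deleting all edges that are not inside `S`. -/
def restr (G : SimpleGraph V) (S : Finset V) : SimpleGraph V where
  Adj u v := G.Adj u v ∧ u ∈ S ∧ v ∈ S
  symm := ⟨fun _ _ h => ⟨h.1.symm, h.2.2, h.2.1⟩⟩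
  loopless := ⟨fun _ h => h.1.ne rfl⟩

lemma restr_adj (G : SimpleGraph V) (S : Finset V) (u v : V) :
    (restr G S).Adj u v ↔ G.Adj u v ∧ u ∈ S ∧ v ∈ S := Iff.rfl

lemma restr_restr [DecidableEq V] (G : SimpleGraph V) (S T : Finset V) :
    restr (restr G S) T = restr G (S ∩ T) := by
  ext u v
  simp only [restr_adj, Finset.mem_inter]
  tauto

lemma IsClosedIn.mem_of_reachable {G : SimpleGraph V} {S : Finset V} (h : IsClosedIn G S)
    {u v : V} (hu : u ∈ S) (huv : G.Reachable u v) : v ∈ S := by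
  obtain ⟨w⟩ := huv
  induction w with
  | nil => exact hu
  | cons hadj _ ih => exact ih (h _ hu _ hadj)

variable [Fintype V]

@[simp] lemma restr_univ (G : SimpleGraph V) : restr G Finset.univ = G := by
  ext u v
  simp [restr_adj]

/-- The union of the connected components of `G` that meet `A`. -/
def hull (G : SimpleGraph V) (A : Finset V) : Finset V :=
  Finset.univ.filter fun u => ∃ a ∈ A, G.Reachable a u

lemma mem_hull {G : SimpleGraph V} {A : Finset V} {u : V} :
    u ∈ hull G A ↔ ∃ a ∈ A, G.Reachable a u := by
  simp [hull]

lemma subset_hull (G : SimpleGraph V) (A : Finset V) : A ⊆ hull G A := fun a ha =>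
  mem_hull.2 ⟨a, ha, SimpleGraph.Reachable.refl a⟩

lemma isClosedIn_hull (G : SimpleGraph V) (A : Finset V) : IsClosedIn G (hull G A) := by
  intro u hu v huv
  obtain ⟨a, ha, h⟩ := mem_hull.1 hu
  exact mem_hull.2 ⟨a, ha, h.trans huv.reachable⟩

lemma hull_subset {G : SimpleGraph V} {A T : Finset V} (hA : A ⊆ T) (hT : IsClosedIn G T) :
    hull G A ⊆ T := by
  intro u hu
  obtain ⟨a, ha, h⟩ := mem_hull.1 hu
  exact hT.mem_of_reachable (hA ha) h

lemma IsClosedIn.compl [DecidableEq V] {G : SimpleGraph V} {S : Finset V} (h : IsClosedIn G S) :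
    IsClosedIn G Sᶜ := by
  intro u hu v huv
  rw [Finset.mem_compl] at hu ⊢
  exact fun hv => hu (h v hv u huv.symm)

lemma hull_singleton_eq_of_mem {G : SimpleGraph V} {u v : V} (h : u ∈ hull G {v}) :
    hull G {u} = hull G {v} := by
  have h' : G.Reachable v u := by simpa [mem_hull] using h
  ext w
  simp only [mem_hull, Finset.mem_singleton, exists_eq_left]
  exact ⟨h'.trans, h'.symm.trans⟩

lemma card_hull_le_sum [DecidableEq V] (G : SimpleGraph V) (A : Finset V) :
    (hull G A).card ≤ ∑ v ∈ A, (hull G {v}).card := by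
  have : hull G A ⊆ A.biUnion fun v => hull G {v} := by
    intro u hu
    obtain ⟨a, ha, h⟩ := mem_hull.1 hu
    exact Finset.mem_biUnion.2 ⟨a, ha, mem_hull.2 ⟨a, by simp, h⟩⟩
  exact (Finset.card_le_card this).trans Finset.card_biUnion_le

lemma hull_restr_subset [DecidableEq V] (G : SimpleGraph V) {A B : Finset V} {a : V} (ha : a ∈ A) :
    hull (restr G B) A ⊆
      insert a (hull (restr G (B.erase a)) (A.erase a ∪ (B \ A).filter (G.Adj a))) := by
  refine hull_subset ?_ ?_
  · intro u hu
    by_cases h : u = a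
    · simp [h]
    · refine Finset.mem_insert_of_mem (subset_hull _ _ ?_)
      simp [h, hu]
  · intro u hu v huv
    rw [restr_adj] at huv
    by_cases hva : v = a
    · simp [hva]
    · refine Finset.mem_insert_of_mem ?_
      by_cases hua : u = a
      · subst hua
        refine subset_hull _ _ ?_
        by_cases hvA : v ∈ A <;> simp [hva, hvA, huv.1, huv.2.2]
      · refine isClosedIn_hull _ _ u (Finset.mem_of_mem_insert_of_ne hu hua) v ?_
        simp [restr_adj, huv, hva, hua]

end Hull

section Exploration

variable {n : ℕ} {p : ℝ} {E : Type*} [AddCommGroup E] [Module ℝ E]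

/-- The pairs of vertices having no member in `T`. -/
def pairsOff (T : Finset (Fin n)) : Set (Sym2 (Fin n)) := {e | ∀ v ∈ e, v ∉ T}

lemma mem_pairsOff {T : Finset (Fin n)} {u v : Fin n} :
    s(u, v) ∈ pairsOff T ↔ u ∉ T ∧ v ∉ T := by
  simp [pairsOff]

lemma hull_mix (A : Finset (Fin n)) (G G' : SimpleGraph (Fin n)) :
    hull (mix (pairsOff (hull G A)) G G') A = hull G A := by
  set T := hull G A with hT
  set H := mix (pairsOff T) G G' with hH
  have hadj : ∀ u v, u ∈ T → (H.Adj u v ↔ G.Adj u v) := fun u v hu => by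
    rw [hH, mix_adj, if_neg]
    simp [mem_pairsOff, hu]
  have hTG : IsClosedIn G T := isClosedIn_hull G A
  refine Finset.Subset.antisymm (hull_subset (subset_hull G A) fun u hu v huv =>
    hTG u hu v ((hadj u v hu).1 huv)) ?_
  have hsub : hull G A ⊆ T ∩ hull H A := by
    refine hull_subset (Finset.subset_inter (subset_hull G A) (subset_hull H A)) ?_
    intro u hu v huv
    rw [Finset.mem_inter] at hu ⊢
    exact ⟨hTG u hu.1 v huv, isClosedIn_hull H A u hu.2 v ((hadj u v hu.1).2 huv)⟩
  exact hsub.trans Finset.inter_subset_right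

lemma restr_mix_pairsOff (T S : Finset (Fin n)) (hST : Disjoint S T)
    (G G' : SimpleGraph (Fin n)) : restr (mix (pairsOff T) G G') S = restr G' S := by
  ext u v
  simp only [restr_adj, mix_adj, mem_pairsOff]
  have h : ∀ w, w ∈ S → w ∉ T := fun _ hw => Finset.disjoint_left.1 hST hw
  constructor
  · rintro ⟨h1, hu, hv⟩
    rw [if_pos ⟨h u hu, h v hv⟩] at h1
    exact ⟨h1, hu, hv⟩
  · rintro ⟨h1, hu, hv⟩
    rw [if_pos ⟨h u hu, h v hv⟩]
    exact ⟨h1, hu, hv⟩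

lemma restr_mix_pairsOff_self (T S : Finset (Fin n)) (hST : S ⊆ T)
    (G G' : SimpleGraph (Fin n)) : restr (mix (pairsOff T) G G') S = restr G S := by
  ext u v
  simp only [restr_adj, mix_adj, mem_pairsOff]
  refine and_congr_left fun h => ?_
  rw [if_neg]
  exact fun h' => h'.1 (hST h.1)

/-- The graph outside the components meeting `A` may be replaced by an independent copy. -/
lemma ev_hull_resample (A : Finset (Fin n))
    (k : Finset (Fin n) → SimpleGraph (Fin n) → SimpleGraph (Fin n) → E) :
    ev p (fun G => k (hull G A) (restr G (hull G A)) (restr G (hull G A)ᶜ))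
      = ev p fun G => ev p fun G' => k (hull G A) (restr G (hull G A)) (restr G' (hull G A)ᶜ) := by
  refine ev_decouple (fun G => pairsOff (hull G A)) (fun G G' => by rw [hull_mix])
    (fun G G' => k (hull G A) (restr G (hull G A)) (restr G' (hull G A)ᶜ)) fun G G' => ?_
  rw [hull_mix, restr_mix_pairsOff_self _ _ subset_rfl,
    restr_mix_pairsOff _ _ disjoint_compl_left]

lemma ev_pow_card_neighbors (a : Fin n) (U : Finset (Fin n)) (ha : a ∉ U) (x : ℝ) :
    ev p (fun G => x ^ (U.filter (G.Adj a)).card) = (1 + p * (x - 1)) ^ U.card := by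
  have hinj : Set.InjOn (fun u => s(a, u)) (U : Set (Fin n)) := fun u _ v _ h => by
    rcases Sym2.eq_iff.1 h with h | h
    · exact h.2
    · exact h.2.trans h.1
  rw [← Finset.card_image_of_injOn hinj, ← ev_prod_edges]
  · congr 1
    ext G
    rw [Finset.prod_image hinj, ← Finset.prod_filter, Finset.prod_const]
    simp only [SimpleGraph.mem_edgeSet]
  · intro e he
    obtain ⟨u, hu, rfl⟩ := Finset.mem_image.1 he
    rw [Sym2.mk_isDiag_iff]
    rintro rfl
    exact ha hu

/-- Exponential moments of the size of a union of components, by exploring vertex after vertex. -/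
lemma ev_pow_card_hull_le (hp0 : 0 ≤ p) (hp1 : p ≤ 1) {c x z : ℝ} (hnp : n * p ≤ c)
    (hx : 1 ≤ x) (hz : 1 ≤ z) (hzx : z * Real.exp (c * (x - 1)) ≤ x) (k : ℕ) :
    ∀ B A : Finset (Fin n), B.card = k → A ⊆ B →
      ev p (fun G => z ^ (hull (restr G B) A).card) ≤ x ^ A.card := by
  induction k with
  | zero =>
    intro B A hB hA
    obtain rfl := Finset.card_eq_zero.1 hB
    obtain rfl := Finset.subset_empty.1 hA
    simp [hull]
  | succ k ih =>
    intro B A hB hA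
    rcases A.eq_empty_or_nonempty with rfl | ⟨a, ha⟩
    · simp [hull]
    have hB' : (B.erase a).card = k := by
      rw [Finset.card_erase_of_mem (hA ha), hB, Nat.add_sub_cancel]
    set N : SimpleGraph (Fin n) → Finset (Fin n) := fun G => (B \ A).filter (G.Adj a) with hN
    have hNmix : ∀ G G', N (mix (pairsOff {a}) G G') = N G := fun G G' => by
      refine Finset.filter_congr fun u _ => ?_
      rw [mix_adj, if_neg]
      simp [mem_pairsOff]
    have hsub : ∀ G, A.erase a ∪ N G ⊆ B.erase a := fun G u hu => by
      rcases Finset.mem_union.1 hu with h | h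
      · exact Finset.erase_subset_erase a hA h
      · simp only [hN, Finset.mem_filter, Finset.mem_sdiff] at h
        exact Finset.mem_erase.2 ⟨h.2.ne', h.1.1⟩
    have hA1 : A.card = (A.erase a).card + 1 := (Finset.card_erase_add_one ha).symm
    calc ev p (fun G => z ^ (hull (restr G B) A).card)
        ≤ ev p (fun G => z * z ^ (hull (restr G (B.erase a)) (A.erase a ∪ N G)).card) := by
          refine ev_mono hp0 hp1 fun G => ?_
          rw [← pow_succ']
          exact pow_le_pow_right₀ hz
            ((Finset.card_le_card (hull_restr_subset G ha)).trans (Finset.card_insert_le _ _))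
      _ = ev p fun G => ev p fun G' =>
            z * z ^ (hull (restr G' (B.erase a)) (A.erase a ∪ N G)).card := by
          refine ev_decouple (fun _ => pairsOff {a}) (fun _ _ => rfl)
            (fun G G' => z * z ^ (hull (restr G' (B.erase a)) (A.erase a ∪ N G)).card)
            fun G G' => ?_
          rw [hNmix, restr_mix_pairsOff _ _ (by simp)]
      _ ≤ ev p fun G => z * x ^ (A.erase a).card * x ^ (N G).card := by
          refine ev_mono hp0 hp1 fun G => ?_
          rw [ev_mul_left, mul_assoc, ← pow_add]
          refine mul_le_mul_of_nonneg_left ((ih _ _ hB' (hsub G)).trans ?_) (by linarith)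
          exact pow_le_pow_right₀ hx (Finset.card_union_le _ _)
      _ = z * x ^ (A.erase a).card * (1 + p * (x - 1)) ^ (B \ A).card := by
          rw [ev_mul_left, ev_pow_card_neighbors a _ (by simp [ha])]
      _ ≤ z * x ^ (A.erase a).card * Real.exp (c * (x - 1)) := by
          refine mul_le_mul_of_nonneg_left ?_ (by positivity)
          have hpx : 0 ≤ p * (x - 1) := mul_nonneg hp0 (by linarith)
          have hcard : ((B \ A).card : ℝ) ≤ n := by
            exact_mod_cast (Finset.card_le_univ _).trans (by simp)
          calc (1 + p * (x - 1)) ^ (B \ A).card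
              ≤ Real.exp (p * (x - 1)) ^ (B \ A).card := by
                refine pow_le_pow_left₀ (by linarith) ?_ _
                linarith [Real.add_one_le_exp (p * (x - 1))]
            _ = Real.exp ((B \ A).card * (p * (x - 1))) := (Real.exp_nat_mul _ _).symm
            _ ≤ Real.exp (c * (x - 1)) := by
                refine Real.exp_le_exp.2 ?_
                nlinarith [mul_le_mul_of_nonneg_right hcard hpx]
      _ ≤ x ^ A.card := by
          rw [hA1, pow_succ]
          nlinarith [pow_nonneg (by linarith : (0 : ℝ) ≤ x) (A.erase a).card]

/-- Subcritical second moment bound for the size of a component, uniform in `n`. -/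
lemma exists_ev_card_hull_sq_le {c : ℝ} (hc0 : 0 < c) (hc1 : c < 1) :
    ∃ M : ℝ, 0 ≤ M ∧ ∀ (n : ℕ) (p : ℝ), 0 ≤ p → p ≤ 1 → n * p ≤ c → ∀ v : Fin n,
      ev p (fun G => ((hull G {v}).card : ℝ) ^ 2) ≤ M := by
  set ε : ℝ := (1 - c) ^ 3 / 3 with hε
  have hε0 : 0 < ε := by have : 0 < 1 - c := by linarith
                         positivity
  have hε1 : ε ≤ 1 := by
    have : (1 - c) ^ 3 ≤ 1 := pow_le_one₀ (by linarith) (by linarith)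
    linarith
  have hz : (1 + ε) ^ 2 * Real.exp (c * (2 - c - 1)) ≤ 2 - c := by
    set y := c * (2 - c - 1) with hy
    have h1 : (1 + ε) ^ 2 ≤ (2 - c) * (1 - y) := by
      have : (2 - c) * (1 - y) = 1 + 3 * ε := by rw [hy, hε]; ring
      nlinarith
    have h2 : (1 - y) * Real.exp y ≤ 1 := by
      have := mul_le_mul_of_nonneg_right (Real.one_sub_le_exp_neg y) (Real.exp_pos y).le
      rwa [← Real.exp_add, neg_add_cancel, Real.exp_zero] at this
    calc (1 + ε) ^ 2 * Real.exp y ≤ (2 - c) * (1 - y) * Real.exp y :=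
          mul_le_mul_of_nonneg_right h1 (Real.exp_pos y).le
      _ ≤ 2 - c := by nlinarith
  refine ⟨(2 - c) / ε ^ 2, div_nonneg (by linarith) (by positivity), fun n p hp0 hp1 hnp v => ?_⟩
  have h := ev_pow_card_hull_le hp0 hp1 hnp (by linarith) (by nlinarith) hz _ Finset.univ {v} rfl
    (Finset.subset_univ _)
  simp only [restr_univ, Finset.card_singleton, pow_one] at h
  rw [le_div_iff₀ (by positivity), ← ev_mul_right]
  refine (ev_mono hp0 hp1 fun G => ?_).trans h
  rw [← mul_pow, ← pow_mul, mul_comm 2, pow_mul]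
  refine pow_le_pow_left₀ (by positivity) ?_ 2
  have := one_add_mul_le_pow (by linarith : -2 ≤ ε) (hull G {v}).card
  linarith

end Exploration

/-! ### A component-additive variant of the metric dimension -/

section StrongDim

variable {V : Type*}

/-- `R` hits the component of every vertex of `S` and resolves any two vertices of `S` in the same
component. -/
def StrongOn (G : SimpleGraph V) (S R : Finset V) : Prop :=
  (∀ u ∈ S, ∃ w ∈ R, G.Reachable u w) ∧
    ∀ u ∈ S, ∀ v ∈ S, u ≠ v → G.Reachable u v → ∃ w ∈ R, G.edist u w ≠ G.edist v w

lemma StrongOn.mono {G : SimpleGraph V} {S R R' : Finset V} (h : StrongOn G S R) (hR : R ⊆ R') :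
    StrongOn G S R' :=
  ⟨fun u hu => (h.1 u hu).imp fun _ hw => ⟨hR hw.1, hw.2⟩,
    fun u hu v hv huv hr => (h.2 u hu v hv huv hr).imp fun _ hw => ⟨hR hw.1, hw.2⟩⟩

lemma IsClosedIn.mem_of_edist_ne {G : SimpleGraph V} {S : Finset V} (hS : IsClosedIn G S)
    {u v w : V} (hu : u ∈ S) (hv : v ∈ S) (h : G.edist u w ≠ G.edist v w) : w ∈ S := by
  by_contra hw
  refine h ?_
  rw [SimpleGraph.edist_eq_top_of_not_reachable fun hr => hw (hS.mem_of_reachable hu hr),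
    SimpleGraph.edist_eq_top_of_not_reachable fun hr => hw (hS.mem_of_reachable hv hr)]

lemma StrongOn.inter [DecidableEq V] {G : SimpleGraph V} {S R : Finset V} (hS : IsClosedIn G S)
    (h : StrongOn G S R) : StrongOn G S (R ∩ S) := by
  refine ⟨fun u hu => ?_, fun u hu v hv huv hr => ?_⟩
  · obtain ⟨w, hw, hr⟩ := h.1 u hu
    exact ⟨w, Finset.mem_inter.2 ⟨hw, hS.mem_of_reachable hu hr⟩, hr⟩
  · obtain ⟨w, hw, hne⟩ := h.2 u hu v hv huv hr
    exact ⟨w, Finset.mem_inter.2 ⟨hw, hS.mem_of_edist_ne hu hv hne⟩, hne⟩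

lemma IsClosedIn.exists_walk_restr {G : SimpleGraph V} {S : Finset V} (hS : IsClosedIn G S)
    {u w : V} (hu : u ∈ S) (q : G.Walk u w) : ∃ r : (restr G S).Walk u w, r.length = q.length := by
  induction q with
  | nil => exact ⟨SimpleGraph.Walk.nil, rfl⟩
  | cons hadj _ ih =>
    have hv := hS _ hu _ hadj
    obtain ⟨r, hr⟩ := ih hv
    have hadj' := (restr_adj G S _ _).2 ⟨hadj, hu, hv⟩
    exact ⟨SimpleGraph.Walk.cons hadj' r, by simp [hr]⟩

lemma IsClosedIn.edist_restr {G : SimpleGraph V} {S : Finset V} (hS : IsClosedIn G S)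
    {u : V} (hu : u ∈ S) (w : V) : (restr G S).edist u w = G.edist u w := by
  refine le_antisymm ?_ (SimpleGraph.edist_anti fun _ _ h => h.1)
  by_cases h : G.Reachable u w
  · obtain ⟨q, hq⟩ := h.exists_walk_length_eq_edist
    obtain ⟨r, hr⟩ := hS.exists_walk_restr hu q
    rw [← hq, ← hr]
    exact SimpleGraph.edist_le r
  · rw [SimpleGraph.edist_eq_top_of_not_reachable h]
    exact le_top

lemma IsClosedIn.reachable_restr {G : SimpleGraph V} {S : Finset V} (hS : IsClosedIn G S)
    {u : V} (hu : u ∈ S) (w : V) : (restr G S).Reachable u w ↔ G.Reachable u w := by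
  rw [← SimpleGraph.edist_ne_top_iff_reachable, ← SimpleGraph.edist_ne_top_iff_reachable,
    hS.edist_restr hu]

lemma eq_of_reachable_restr {G : SimpleGraph V} {S : Finset V} {u w : V} (hu : u ∉ S)
    (h : (restr G S).Reachable u w) : u = w := by
  have hc : IsClosedIn (restr G S) {u} := fun a ha b hab => by
    rw [Finset.mem_singleton.1 ha] at hab
    exact absurd hab.2.1 hu
  exact (Finset.mem_singleton.1 (hc.mem_of_reachable (Finset.mem_singleton_self u) h)).symm

lemma isClosedIn_restr_self (G : SimpleGraph V) (S : Finset V) : IsClosedIn (restr G S) S :=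
  fun _ _ _ h => h.2.2

variable [Fintype V]

/-- The least size of a set hitting every component and resolving each of them. -/
def strongDim (G : SimpleGraph V) : ℕ :=
  sInf {m : ℕ | ∃ R : Finset V, R.card = m ∧ StrongOn G Finset.univ R}

lemma strongDim_le {G : SimpleGraph V} {R : Finset V} (h : StrongOn G Finset.univ R) :
    strongDim G ≤ R.card := Nat.sInf_le ⟨R, rfl, h⟩

lemma strongOn_univ_univ (G : SimpleGraph V) : StrongOn G Finset.univ Finset.univ :=
  ⟨fun u _ => ⟨u, Finset.mem_univ _, SimpleGraph.Reachable.refl u⟩, fun u _ v _ huv _ =>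
    ⟨u, Finset.mem_univ _, by
      rw [SimpleGraph.edist_self]
      exact (SimpleGraph.edist_pos_of_ne huv.symm).ne⟩⟩

lemma exists_strongOn_card_eq (G : SimpleGraph V) :
    ∃ R : Finset V, R.card = strongDim G ∧ StrongOn G Finset.univ R :=
  Nat.sInf_mem (s := {m : ℕ | ∃ R : Finset V, R.card = m ∧ StrongOn G Finset.univ R})
    ⟨_, Finset.univ, rfl, strongOn_univ_univ G⟩

lemma strongDim_le_card (G : SimpleGraph V) : strongDim G ≤ Fintype.card V :=
  strongDim_le (strongOn_univ_univ G)

variable [DecidableEq V]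

lemma strongOn_univ_iff {G : SimpleGraph V} {S R : Finset V} (hS : IsClosedIn G S) :
    StrongOn G Finset.univ R ↔ StrongOn G S R ∧ StrongOn G Sᶜ R := by
  constructor
  · exact fun h => ⟨⟨fun u _ => h.1 u (Finset.mem_univ _), fun u _ v _ =>
      h.2 u (Finset.mem_univ _) v (Finset.mem_univ _)⟩, fun u _ => h.1 u (Finset.mem_univ _),
      fun u _ v _ => h.2 u (Finset.mem_univ _) v (Finset.mem_univ _)⟩
  · rintro ⟨h1, h2⟩
    refine ⟨fun u _ => ?_, fun u _ v _ huv hr => ?_⟩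
    · by_cases hu : u ∈ S
      · exact h1.1 u hu
      · exact h2.1 u (Finset.mem_compl.2 hu)
    · by_cases hu : u ∈ S
      · exact h1.2 u hu v (hS.mem_of_reachable hu hr) huv hr
      · rw [← Finset.mem_compl] at hu
        exact h2.2 u hu v (hS.compl.mem_of_reachable hu hr) huv hr

lemma strongOn_restr_univ_iff {G : SimpleGraph V} {S R : Finset V} (hS : IsClosedIn G S) :
    StrongOn (restr G S) Finset.univ R ↔ Sᶜ ⊆ R ∧ StrongOn G S R := by
  constructor
  · refine fun h => ⟨fun u hu => ?_, fun u hu => ?_, fun u hu v hv huv hr => ?_⟩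
    · obtain ⟨w, hw, hr⟩ := h.1 u (Finset.mem_univ _)
      rwa [eq_of_reachable_restr (Finset.mem_compl.1 hu) hr]
    · simpa only [hS.reachable_restr hu] using h.1 u (Finset.mem_univ _)
    · simpa only [hS.edist_restr hu, hS.edist_restr hv] using
        h.2 u (Finset.mem_univ _) v (Finset.mem_univ _) huv ((hS.reachable_restr hu v).2 hr)
  · rintro ⟨hR, h⟩
    refine ⟨fun u _ => ?_, fun u _ v _ huv hr => ?_⟩
    · by_cases hu : u ∈ S
      · simpa only [hS.reachable_restr hu] using h.1 u hu
      · exact ⟨u, hR (Finset.mem_compl.2 hu), SimpleGraph.Reachable.refl u⟩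
    · by_cases hu : u ∈ S
      · rw [hS.reachable_restr hu] at hr
        have hv := hS.mem_of_reachable hu hr
        simpa only [hS.edist_restr hu, hS.edist_restr hv] using h.2 u hu v hv huv hr
      · exact absurd (eq_of_reachable_restr hu hr) huv

lemma strongDim_add_card {G : SimpleGraph V} {S : Finset V} (hS : IsClosedIn G S) :
    strongDim G + Fintype.card V = strongDim (restr G S) + strongDim (restr G Sᶜ) := by
  apply le_antisymm
  · obtain ⟨R₁, h₁, hR₁⟩ := exists_strongOn_card_eq (restr G S)
    obtain ⟨R₂, h₂, hR₂⟩ := exists_strongOn_card_eq (restr G Sᶜ)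
    rw [strongOn_restr_univ_iff hS] at hR₁
    rw [strongOn_restr_univ_iff hS.compl, compl_compl] at hR₂
    have hR : StrongOn G Finset.univ (R₁ ∩ R₂) := by
      rw [strongOn_univ_iff hS]
      refine ⟨(hR₁.2.inter hS).mono ?_, (hR₂.2.inter hS.compl).mono ?_⟩
      · exact Finset.inter_subset_inter_left hR₂.1
      · rw [Finset.inter_comm]
        exact Finset.inter_subset_inter_right hR₁.1
    have hun : R₁ ∪ R₂ = Finset.univ := by
      refine Finset.eq_univ_of_forall fun u => ?_
      by_cases hu : u ∈ S
      · exact Finset.mem_union_right _ (hR₂.1 hu)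
      · exact Finset.mem_union_left _ (hR₁.1 (Finset.mem_compl.2 hu))
    have hc := Finset.card_union_add_card_inter R₁ R₂
    rw [hun, Finset.card_univ] at hc
    have := strongDim_le hR
    omega
  · obtain ⟨R, h, hR⟩ := exists_strongOn_card_eq G
    rw [strongOn_univ_iff hS] at hR
    have h₁ : strongDim (restr G S) ≤ (R ∪ Sᶜ).card := strongDim_le <|
      (strongOn_restr_univ_iff hS).2
        ⟨Finset.subset_union_right, hR.1.mono Finset.subset_union_left⟩
    have h₂ : strongDim (restr G Sᶜ) ≤ (R ∪ S).card := strongDim_le <|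
      (strongOn_restr_univ_iff hS.compl).2
        ⟨by simp, hR.2.mono Finset.subset_union_left⟩
    have hc := Finset.card_union_add_card_inter (R ∪ Sᶜ) (R ∪ S)
    have hun : (R ∪ Sᶜ) ∪ (R ∪ S) = Finset.univ := by
      ext u
      simp only [Finset.mem_union, Finset.mem_compl, Finset.mem_univ, iff_true]
      tauto
    have hin : (R ∪ Sᶜ) ∩ (R ∪ S) = R := by
      ext u
      simp only [Finset.mem_union, Finset.mem_compl, Finset.mem_inter]
      tauto
    rw [hun, hin, Finset.card_univ] at hc
    omega

lemma compl_subset_of_strongOn_restr {G : SimpleGraph V} {S R : Finset V}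
    (h : StrongOn (restr G S) Finset.univ R) : Sᶜ ⊆ R := by
  have := (strongOn_restr_univ_iff (R := R) (isClosedIn_restr_self G S)).1
  rw [restr_restr, Finset.inter_self] at this
  exact (this h).1

lemma card_le_strongDim_restr_add (G : SimpleGraph V) (S : Finset V) :
    Fintype.card V ≤ strongDim (restr G S) + S.card := by
  obtain ⟨R, h, hR⟩ := exists_strongOn_card_eq (restr G S)
  have h1 := Finset.card_le_card (compl_subset_of_strongOn_restr hR)
  rw [Finset.card_compl] at h1
  omega

lemma strongDim_restr_pair {G : SimpleGraph V} {u v : V} (h : G.Adj u v) :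
    strongDim (restr G {u, v}) + 1 = Fintype.card V := by
  set H := restr G {u, v} with hH
  have hne : u ≠ v := h.ne
  have huv : H.Adj u v := ⟨h, by simp, by simp⟩
  have hpos : 0 < Fintype.card V := Fintype.card_pos_iff.2 ⟨u⟩
  have hle : strongDim H ≤ (Finset.univ.erase v).card := by
    refine strongDim_le ⟨fun a _ => ?_, fun a _ b _ hab _ => ?_⟩
    · by_cases ha : a = v
      · exact ⟨u, by simp [hne], ha ▸ huv.symm.reachable⟩
      · exact ⟨a, by simp [ha], SimpleGraph.Reachable.refl a⟩
    · by_cases ha : a = v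
      · refine ⟨b, by simp [← ha, hab.symm], ?_⟩
        rw [SimpleGraph.edist_self]
        exact (SimpleGraph.edist_pos_of_ne hab).ne'
      · refine ⟨a, by simp [ha], ?_⟩
        rw [SimpleGraph.edist_self]
        exact (SimpleGraph.edist_pos_of_ne hab.symm).ne
  rw [Finset.card_erase_of_mem (Finset.mem_univ v), Finset.card_univ] at hle
  obtain ⟨R, hcard, hR⟩ := exists_strongOn_card_eq H
  obtain ⟨w, hw, hr⟩ := hR.1 u (Finset.mem_univ u)
  have hw' : w ∈ ({u, v} : Finset V) :=
    (isClosedIn_restr_self G {u, v}).mem_of_reachable (by simp) hr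
  have hsub : insert w ({u, v} : Finset V)ᶜ ⊆ R :=
    Finset.insert_subset hw (compl_subset_of_strongOn_restr hR)
  have hc := Finset.card_le_card hsub
  rw [Finset.card_insert_of_notMem (by rwa [Finset.mem_compl, not_not]), Finset.card_compl,
    Finset.card_pair hne] at hc
  omega

lemma metricDim_le_strongDim (G : SimpleGraph V) (hV : Nat.card V ≠ 1) :
    metricDim G ≤ strongDim G := by
  obtain ⟨R, h, hR⟩ := exists_strongOn_card_eq G
  rw [metricDim, if_neg hV, ← h]
  refine Nat.sInf_le ⟨R, by simp, fun u v huv => ?_⟩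
  by_cases hr : G.Reachable u v
  · exact hR.2 u (Finset.mem_univ u) v (Finset.mem_univ v) huv hr
  · obtain ⟨w, hw, hrw⟩ := hR.1 u (Finset.mem_univ u)
    refine ⟨w, hw, ?_⟩
    rw [SimpleGraph.edist_eq_top_of_not_reachable fun hvw => hr (hrw.trans hvw.symm)]
    exact SimpleGraph.edist_ne_top_iff_reachable.2 hrw

lemma strongDim_le_metricDim_add_one (G : SimpleGraph V) (hV : Nat.card V ≠ 1) :
    strongDim G ≤ metricDim G + 1 := by
  have hmem : metricDim G ∈ {m : ℕ | ∃ R : Set V, R.ncard = m ∧ Resolves G R} := by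
    rw [metricDim, if_neg hV]
    refine Nat.sInf_mem ⟨_, Set.univ, rfl, fun u v huv => ⟨u, trivial, ?_⟩⟩
    rw [SimpleGraph.edist_self]
    exact (SimpleGraph.edist_pos_of_ne huv.symm).ne
  obtain ⟨R, hcard, hR⟩ := hmem
  have hcard' : R.toFinset.card = metricDim G := by rw [← hcard, Set.ncard_eq_toFinset_card']
  have hres : ∀ R' : Finset V, R.toFinset ⊆ R' → ∀ u ∈ Finset.univ, ∀ v ∈ Finset.univ, u ≠ v →
      G.Reachable u v → ∃ w ∈ R', G.edist u w ≠ G.edist v w := fun R' hR' u _ v _ huv _ => by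
    obtain ⟨w, hw, hne⟩ := hR u v huv
    exact ⟨w, hR' (by simpa using hw), hne⟩
  by_cases hall : ∀ u, ∃ w ∈ R, G.Reachable u w
  · have : StrongOn G Finset.univ R.toFinset :=
      ⟨fun u _ => by simpa using hall u, hres _ subset_rfl⟩
    have := strongDim_le this
    omega
  · push Not at hall
    obtain ⟨u₀, hu₀⟩ := hall
    have : StrongOn G Finset.univ (insert u₀ R.toFinset) := by
      refine ⟨fun u _ => ?_, hres _ (Finset.subset_insert _ _)⟩
      by_cases hu : u = u₀
      · exact ⟨u₀, Finset.mem_insert_self _ _, hu ▸ SimpleGraph.Reachable.refl u⟩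
      · obtain ⟨w, hw, hne⟩ := hR u u₀ hu
        refine ⟨w, Finset.mem_insert_of_mem (by simpa using hw), ?_⟩
        rw [SimpleGraph.edist_eq_top_of_not_reachable (hu₀ w hw)] at hne
        exact SimpleGraph.edist_ne_top_iff_reachable.1 hne
    have := (strongDim_le this).trans (Finset.card_insert_le _ _)
    omega

end StrongDim

section Deficit

variable {n : ℕ}

/-- A graph parameter that is additive over components and at most their total size. -/
structure IsComponentAdditive (F : SimpleGraph (Fin n) → ℝ) : Prop where
  add_compl : ∀ G S, IsClosedIn G S → F G = F (restr G S) + F (restr G Sᶜ)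
  abs_restr_le : ∀ G S, |F (restr G S)| ≤ S.card

/-- The variant `strongDim` of the metric dimension, normalized to vanish on the empty graph. -/
def deficit (G : SimpleGraph (Fin n)) : ℝ := (strongDim G : ℝ) - n

lemma isComponentAdditive_deficit : IsComponentAdditive (deficit (n := n)) where
  add_compl G S hS := by
    have h := strongDim_add_card hS
    rw [Fintype.card_fin] at h
    have h' : (strongDim G : ℝ) + n = strongDim (restr G S) + strongDim (restr G Sᶜ) := by
      exact_mod_cast h
    simp only [deficit]
    linarith
  abs_restr_le G S := by
    have h1 := strongDim_le_card (restr G S)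
    have h2 := card_le_strongDim_restr_add G S
    rw [Fintype.card_fin] at h1 h2
    have h1' : (strongDim (restr G S) : ℝ) ≤ n := by exact_mod_cast h1
    have h2' : (n : ℝ) ≤ strongDim (restr G S) + S.card := by exact_mod_cast h2
    rw [deficit, abs_le]
    constructor <;> linarith [(Nat.cast_nonneg S.card : (0 : ℝ) ≤ S.card)]

lemma deficit_restr_pair (G : SimpleGraph (Fin n)) (u v : Fin n) :
    deficit (restr G {u, v}) = if G.Adj u v then -1 else 0 := by
  split_ifs with h
  · have h1 := strongDim_restr_pair h
    rw [Fintype.card_fin] at h1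
    have h1' : (strongDim (restr G {u, v}) : ℝ) + 1 = n := by exact_mod_cast h1
    rw [deficit]
    linarith
  · have hbot : restr G {u, v} = restr G ∅ := by
      ext a b
      simp only [restr_adj, Finset.mem_insert, Finset.mem_singleton, Finset.notMem_empty,
        and_false, iff_false, not_and]
      rintro hab (rfl | rfl) (rfl | rfl)
      · exact hab.ne rfl
      · exact h hab
      · exact h hab.symm
      · exact hab.ne rfl
    rw [hbot]
    simpa using isComponentAdditive_deficit.abs_restr_le G ∅

lemma abs_betaR_sub_deficit_le (hn : n ≠ 1) (G : SimpleGraph (Fin n)) :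
    |betaR G - (deficit G + n)| ≤ 1 := by
  have hV : Nat.card (Fin n) ≠ 1 := by simpa using hn
  have h1 : (metricDim G : ℝ) ≤ strongDim G := by exact_mod_cast metricDim_le_strongDim G hV
  have h2 : (strongDim G : ℝ) ≤ metricDim G + 1 := by
    exact_mod_cast strongDim_le_metricDim_add_one G hV
  rw [betaR, deficit, abs_le]
  constructor <;> linarith

end Deficit

/-! ### A Stein-type identity for component-additive parameters -/

section Exponential

/-- The character `y ↦ exp (i t y)`. -/
def ex (t y : ℝ) : ℂ := Complex.exp (Complex.I * ((t * y : ℝ) : ℂ))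

lemma ex_add (t a b : ℝ) : ex t (a + b) = ex t a * ex t b := by
  rw [ex, ex, ex, ← Complex.exp_add]
  push_cast
  ring_nf

lemma norm_ex (t a : ℝ) : ‖ex t a‖ = 1 := Complex.norm_exp_I_mul_ofReal _

lemma norm_ex_sub_one_le (t a : ℝ) : ‖ex t a - 1‖ ≤ |t| * |a| := by
  rw [← abs_mul]
  exact Real.norm_exp_I_mul_ofReal_sub_one_le

lemma norm_ex_sub_le (t a b : ℝ) : ‖ex t a - ex t b‖ ≤ |t| * |a - b| := by
  have h : ex t a - ex t b = ex t b * (ex t (a - b) - 1) := by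
    rw [mul_sub, ← ex_add]; simp
  rw [h, norm_mul, norm_ex, one_mul]
  exact norm_ex_sub_one_le t _

lemma norm_ex_sub_one_sub_le (t a : ℝ) :
    ‖ex t a - 1 - Complex.I * t * a‖ ≤ 2 * (t ^ 2 * a ^ 2) := by
  have hx : Complex.I * t * a = Complex.I * ((t * a : ℝ) : ℂ) := by push_cast; ring
  have hn : ‖Complex.I * ((t * a : ℝ) : ℂ)‖ = |t * a| := by simp
  have hsq : t ^ 2 * a ^ 2 = |t * a| ^ 2 := by rw [sq_abs]; ring
  rw [hx, hsq]
  rcases le_total |t * a| 1 with h | h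
  · have := Complex.norm_exp_sub_one_sub_id_le (hn.trans_le h)
    rw [hn] at this
    rw [ex]
    nlinarith [sq_nonneg |t * a|]
  · calc _ ≤ ‖ex t a - 1‖ + ‖Complex.I * ((t * a : ℝ) : ℂ)‖ := norm_sub_le _ _
      _ ≤ |t * a| + |t * a| := add_le_add (by rw [abs_mul]; exact norm_ex_sub_one_le t a) hn.le
      _ ≤ _ := by nlinarith

end Exponential

section Stein

variable {n : ℕ} {p M : ℝ} {F : SimpleGraph (Fin n) → ℝ}

lemma cast_card_hull_le_sum (G : SimpleGraph (Fin n)) (S : Finset (Fin n)) :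
    ((hull G S).card : ℝ) ≤ ∑ v ∈ S, ((hull G {v}).card : ℝ) := by
  exact_mod_cast card_hull_le_sum G S

lemma ev_card_hull_le (hp0 : 0 ≤ p) (hp1 : p ≤ 1)
    (hM : ∀ v : Fin n, ev p (fun G => ((hull G {v}).card : ℝ) ^ 2) ≤ M) (S : Finset (Fin n)) :
    ev p (fun G => ((hull G S).card : ℝ)) ≤ M * S.card := by
  calc ev p (fun G => ((hull G S).card : ℝ))
      ≤ ev p (fun G => ∑ v ∈ S, ((hull G {v}).card : ℝ) ^ 2) := by
        refine ev_mono hp0 hp1 fun G => (cast_card_hull_le_sum G S).trans ?_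
        refine Finset.sum_le_sum fun v _ => ?_
        exact_mod_cast Nat.le_self_pow two_ne_zero _
    _ ≤ ∑ _v ∈ S, M := by
        rw [ev_sum]
        exact Finset.sum_le_sum fun v _ => hM v
    _ = M * S.card := by rw [Finset.sum_const, nsmul_eq_mul, mul_comm]

lemma ev_card_hull_sq_le (hp0 : 0 ≤ p) (hp1 : p ≤ 1)
    (hM : ∀ v : Fin n, ev p (fun G => ((hull G {v}).card : ℝ) ^ 2) ≤ M) (S : Finset (Fin n)) :
    ev p (fun G => ((hull G S).card : ℝ) ^ 2) ≤ M * (S.card : ℝ) ^ 2 := by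
  calc ev p (fun G => ((hull G S).card : ℝ) ^ 2)
      ≤ ev p (fun G => S.card * ∑ v ∈ S, ((hull G {v}).card : ℝ) ^ 2) := by
        refine ev_mono hp0 hp1 fun G => le_trans ?_ sq_sum_le_card_mul_sum_sq
        exact pow_le_pow_left₀ (by positivity) (cast_card_hull_le_sum G S) 2
    _ ≤ S.card * ∑ _v ∈ S, M := by
        rw [ev_mul_left, ev_sum]
        exact mul_le_mul_of_nonneg_left (Finset.sum_le_sum fun v _ => hM v) (by positivity)
    _ = M * (S.card : ℝ) ^ 2 := by rw [Finset.sum_const, nsmul_eq_mul]; ring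

namespace IsComponentAdditive

/-- The change of `F` caused by isolating the vertices of `S` depends on the components meeting
`S` only. -/
lemma sub_restr_compl (hF : IsComponentAdditive F) (G : SimpleGraph (Fin n))
    (S : Finset (Fin n)) :
    F G - F (restr G Sᶜ) =
      F (restr G (hull G S)) - F (restr (restr G (hull G S)) Sᶜ) := by
  set T := hull G S with hT
  have hcl : IsClosedIn G T := isClosedIn_hull G S
  have h1 := hF.add_compl G T hcl
  have h2 := hF.add_compl (restr G Sᶜ) T fun u hu v huv => hcl u hu v huv.1
  have h3 : Sᶜ ∩ Tᶜ = Tᶜ := Finset.inter_eq_right.2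
    (Finset.compl_subset_compl.2 (subset_hull G S))
  rw [restr_restr, restr_restr, h3] at h2
  rw [h1, h2, restr_restr, Finset.inter_comm]
  ring

lemma abs_sub_restr_compl_le (hF : IsComponentAdditive F) (G : SimpleGraph (Fin n))
    (S : Finset (Fin n)) : |F G - F (restr G Sᶜ)| ≤ 2 * (hull G S).card := by
  rw [hF.sub_restr_compl, restr_restr]
  have h1 := hF.abs_restr_le G (hull G S)
  have h2 := hF.abs_restr_le G (hull G S ∩ Sᶜ)
  have h3 : ((hull G S ∩ Sᶜ).card : ℝ) ≤ (hull G S).card := by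
    exact_mod_cast Finset.card_le_card Finset.inter_subset_left
  exact (abs_sub _ _).trans (by linarith)

lemma norm_ev_ex_restr_sub_le (hF : IsComponentAdditive F) (hp0 : 0 ≤ p) (hp1 : p ≤ 1)
    (hM : ∀ v : Fin n, ev p (fun G => ((hull G {v}).card : ℝ) ^ 2) ≤ M) (t : ℝ)
    (S : Finset (Fin n)) :
    ‖ev p (fun G => ex t (F (restr G Sᶜ))) - ev p (fun G => ex t (F G))‖
      ≤ |t| * (2 * M * S.card) := by
  rw [← ev_sub]
  calc _ ≤ ev p (fun G => |t| * 2 * (hull G S).card) := by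
        refine norm_ev_le hp0 hp1 fun G => (norm_ex_sub_le _ _ _).trans ?_
        rw [abs_sub_comm, mul_assoc]
        exact mul_le_mul_of_nonneg_left (hF.abs_sub_restr_compl_le G S) (abs_nonneg t)
    _ ≤ |t| * 2 * (M * S.card) := by
        rw [ev_mul_left]
        exact mul_le_mul_of_nonneg_left (ev_card_hull_le hp0 hp1 hM S) (by positivity)
    _ = _ := by ring

lemma norm_ev_sub_restr_mul_ex_le (hF : IsComponentAdditive F) (hp0 : 0 ≤ p) (hp1 : p ≤ 1)
    (hM0 : 0 ≤ M)
    (hM : ∀ v : Fin n, ev p (fun G => ((hull G {v}).card : ℝ) ^ 2) ≤ M) (t : ℝ)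
    (S : Finset (Fin n)) :
    ‖ev p (fun G => ((F G - F (restr G Sᶜ) : ℝ) : ℂ) * ex t (F G))
        - ev p (fun G => ((F G - F (restr G Sᶜ) : ℝ) : ℂ)) * ev p (fun G => ex t (F G))‖
      ≤ |t| * (2 * (1 + 2 * M) * M * (S.card : ℝ) ^ 2) := by
  set ψ := ev p (fun G => ex t (F G)) with hψ
  have h1 : ev p (fun G => ((F G - F (restr G Sᶜ) : ℝ) : ℂ) * ex t (F G))
      = ev p fun G => ((F G - F (restr G Sᶜ) : ℝ) : ℂ) * (ex t (F (restr G (hull G S))) *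
          ev p fun G' => ex t (F (restr G' (hull G S)ᶜ))) := by
    have := ev_hull_resample (p := p) S fun _ H H' =>
      ((F H - F (restr H Sᶜ) : ℝ) : ℂ) * (ex t (F H) * ex t (F H'))
    simp only [ev_mul_left, ← hF.sub_restr_compl] at this
    rw [← this]
    congr 1
    ext G
    rw [← ex_add, ← hF.add_compl G _ (isClosedIn_hull G S)]
  rw [h1, ← ev_mul_right, ← ev_sub]
  calc _ ≤ ev p fun G => 2 * (1 + 2 * M) * |t| * ((hull G S).card : ℝ) ^ 2 := by
        refine norm_ev_le hp0 hp1 fun G => ?_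
        set T := hull G S with hT
        set B := ev p fun G' => ex t (F (restr G' Tᶜ)) with hB
        have hd := hF.abs_sub_restr_compl_le G S
        have hB1 := hF.norm_ev_ex_restr_sub_le hp0 hp1 hM t T
        rw [← hB, ← hψ] at hB1
        have ha := hF.abs_restr_le G T
        have he := norm_ex_sub_one_le t (F (restr G T))
        have hψ1 : ‖ψ‖ ≤ 1 := by
          refine (norm_ev_le hp0 hp1 (g := fun _ => 1) fun G => (norm_ex _ _).le).trans_eq ?_
          simp
        have hdiff : ‖ex t (F (restr G T)) * B - ψ‖ ≤ (1 + 2 * M) * |t| * T.card := by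
          calc ‖ex t (F (restr G T)) * B - ψ‖
              = ‖ex t (F (restr G T)) * (B - ψ) + (ex t (F (restr G T)) - 1) * ψ‖ := by
                congr 1; ring
            _ ≤ 1 * ‖B - ψ‖ + ‖ex t (F (restr G T)) - 1‖ * ‖ψ‖ := by
                refine (norm_add_le _ _).trans_eq ?_
                rw [norm_mul, norm_mul, norm_ex]
            _ ≤ 1 * (|t| * (2 * M * T.card)) + |t| * T.card * 1 := by
                gcongr
                exact he.trans (mul_le_mul_of_nonneg_left ha (abs_nonneg t))
            _ = _ := by ring
        rw [← mul_sub, norm_mul, Complex.norm_real, Real.norm_eq_abs]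
        calc _ ≤ (2 * T.card) * ((1 + 2 * M) * |t| * T.card) := by gcongr
          _ = _ := by ring
    _ ≤ 2 * (1 + 2 * M) * |t| * (M * (S.card : ℝ) ^ 2) := by
        rw [ev_mul_left]
        exact mul_le_mul_of_nonneg_left (ev_card_hull_sq_le hp0 hp1 hM S) (by positivity)
    _ = _ := by ring

/-- First-order expansion of the characteristic function after isolating `S`. -/
lemma norm_ev_ex_restr_sub_expansion_le (hF : IsComponentAdditive F) (hp0 : 0 ≤ p) (hp1 : p ≤ 1)
    (hM0 : 0 ≤ M)
    (hM : ∀ v : Fin n, ev p (fun G => ((hull G {v}).card : ℝ) ^ 2) ≤ M) (t : ℝ)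
    (S : Finset (Fin n)) :
    ‖ev p (fun G => ex t (F (restr G Sᶜ))) - ev p (fun G => ex t (F G)) *
        (1 - Complex.I * t * (ev p (fun G => F G - F (restr G Sᶜ)) : ℝ))‖
      ≤ (10 * M + 4 * M ^ 2) * (t ^ 2 * (S.card : ℝ) ^ 2) := by
  set ψ := ev p (fun G => ex t (F G)) with hψ
  set D : SimpleGraph (Fin n) → ℝ := fun G => F G - F (restr G Sᶜ) with hD
  have hsplit : ev p (fun G => ex t (F (restr G Sᶜ))) - ψ * (1 - Complex.I * t * (ev p D : ℝ))
      = ev p (fun G => ex t (F G) * (ex t (-D G) - 1 - Complex.I * t * (-D G : ℝ)))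
        - Complex.I * t * (ev p (fun G => (D G : ℂ) * ex t (F G))
          - ev p (fun G => (D G : ℂ)) * ψ) := by
    have : ∀ G, ex t (F G) * (ex t (-D G) - 1 - Complex.I * t * (-D G : ℝ))
        = ex t (F (restr G Sᶜ)) - ex t (F G) + Complex.I * t * ((D G : ℂ) * ex t (F G)) := by
      intro G
      have : ex t (F (restr G Sᶜ)) = ex t (F G) * ex t (-D G) := by
        rw [← ex_add]; simp [hD]
      rw [this]; push_cast; ring
    simp only [this]
    rw [ev_add, ev_sub (fun G => ex t (F (restr G Sᶜ))) (fun G => ex t (F G)), ev_mul_left,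
      ev_ofReal]
    ring
  have h1 : ‖ev p (fun G => ex t (F G) * (ex t (-D G) - 1 - Complex.I * t * (-D G : ℝ)))‖
      ≤ 8 * t ^ 2 * (M * (S.card : ℝ) ^ 2) := by
    calc _ ≤ ev p fun G => 8 * t ^ 2 * ((hull G S).card : ℝ) ^ 2 := by
          refine norm_ev_le hp0 hp1 fun G => ?_
          rw [norm_mul, norm_ex, one_mul]
          refine (norm_ex_sub_one_sub_le t (-D G)).trans ?_
          have h := pow_le_pow_left₀ (abs_nonneg _) (hF.abs_sub_restr_compl_le G S) 2
          rw [sq_abs] at h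
          have := mul_le_mul_of_nonneg_left h (sq_nonneg t)
          simp only [hD, neg_sq]
          linarith
      _ ≤ _ := by
          rw [ev_mul_left]
          exact mul_le_mul_of_nonneg_left (ev_card_hull_sq_le hp0 hp1 hM S) (by positivity)
  have h2 := hF.norm_ev_sub_restr_mul_ex_le hp0 hp1 hM0 hM t S
  rw [← hψ] at h2
  rw [hsplit]
  calc _ ≤ 8 * t ^ 2 * (M * (S.card : ℝ) ^ 2)
        + |t| * (|t| * (2 * (1 + 2 * M) * M * (S.card : ℝ) ^ 2)) := by
        refine (norm_sub_le _ _).trans (add_le_add h1 ?_)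
        rw [norm_mul, norm_mul, Complex.norm_I, one_mul, Complex.norm_real, Real.norm_eq_abs]
        exact mul_le_mul_of_nonneg_left h2 (abs_nonneg t)
    _ = _ := by rw [← mul_assoc |t|, ← sq, sq_abs]; ring

/-- `F` splits evenly over the vertices of each component. -/
lemma eq_sum_div (hF : IsComponentAdditive F) (G : SimpleGraph (Fin n)) :
    F G = ∑ v, F (restr G (hull G {v})) / (hull G {v}).card := by
  suffices h : ∀ k, ∀ B : Finset (Fin n), B.card = k → IsClosedIn G B →
      F (restr G B) = ∑ v ∈ B, F (restr G (hull G {v})) / (hull G {v}).card by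
    simpa using h _ Finset.univ rfl fun _ _ _ _ => Finset.mem_univ _
  intro k
  induction k using Nat.strong_induction_on with
  | _ k ih =>
    intro B hB hcl
    rcases B.eq_empty_or_nonempty with rfl | ⟨v, hv⟩
    · simpa using hF.abs_restr_le G ∅
    set C := hull G {v} with hC
    have hvC : v ∈ C := subset_hull G {v} (Finset.mem_singleton_self v)
    have hCB : C ⊆ B := hull_subset (by simpa using hv) hcl
    have hCcl : IsClosedIn G C := isClosedIn_hull G {v}
    have hdiff : IsClosedIn G (B \ C) := fun u hu w huw => by
      rw [Finset.mem_sdiff] at hu ⊢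
      exact ⟨hcl u hu.1 w huw, fun hw => hu.2 (hCcl w hw u huw.symm)⟩
    have hlt : (B \ C).card < k := hB ▸ Finset.card_lt_card
      (Finset.sdiff_ssubset hCB ⟨v, hvC⟩)
    have h1 := hF.add_compl (restr G B) C fun u hu w huw => hCcl u hu w huw.1
    rw [restr_restr, restr_restr, Finset.inter_eq_right.2 hCB, ← Finset.sdiff_eq_inter_compl,
      ih _ hlt _ rfl hdiff] at h1
    rw [h1, ← Finset.sum_sdiff hCB, add_comm]
    congr 1
    have hconst : ∀ u ∈ C, F (restr G (hull G {u})) / (hull G {u}).card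
        = F (restr G C) / C.card := fun u hu => by
      rw [hull_singleton_eq_of_mem hu]
    rw [Finset.sum_congr rfl hconst, Finset.sum_const, nsmul_eq_mul, mul_div_cancel₀]
    exact_mod_cast (Finset.card_pos.2 ⟨v, hvC⟩).ne'

/-- The contribution to the variance of the component of `v`. -/
def varTerm (p : ℝ) (F : SimpleGraph (Fin n) → ℝ) (v : Fin n) : ℝ :=
  ev p fun G => F (restr G (hull G {v})) / (hull G {v}).card *
    (F (restr G (hull G {v})) - ev p fun G' => F G' - F (restr G' (hull G {v})ᶜ))

lemma ev_div_mul_self (hF : IsComponentAdditive F) (v : Fin n) :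
    ev p (fun G => F (restr G (hull G {v})) / (hull G {v}).card * F G)
      = varTerm p F v + ev p (fun G => F (restr G (hull G {v})) / (hull G {v}).card) * ev p F := by
  have := ev_hull_resample (p := p) {v} fun T H H' => F H / T.card * (F H + F H')
  simp only [ev_mul_left, ev_add, ev_const] at this
  rw [varTerm, ← ev_mul_right, ← ev_add]
  convert this using 2
  · ext G
    rw [← hF.add_compl G _ (isClosedIn_hull G {v})]
  · ext G
    rw [ev_sub]
    ring

lemma ev_sq_eq (hF : IsComponentAdditive F) :
    ev p (fun G => (F G - ev p F) ^ 2) = ∑ v, varTerm p F v := by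
  have h1 : ev p (fun G => F G * F G) = ∑ v, varTerm p F v + ev p F * ev p F := by
    have hμ : ev p F = ∑ v, ev p (fun G => F (restr G (hull G {v})) / (hull G {v}).card) := by
      rw [← ev_sum]
      congr 1
      ext G
      exact hF.eq_sum_div G
    nth_rewrite 1 [hμ]
    rw [Finset.sum_mul, ← Finset.sum_add_distrib]
    simp only [← hF.ev_div_mul_self]
    rw [← ev_sum]
    congr 1
    ext G
    rw [← Finset.sum_mul, ← hF.eq_sum_div G]
  have h2 : ∀ G, (F G - ev p F) ^ 2 = F G * F G - (2 * ev p F * F G - ev p F * ev p F) :=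
    fun G => by ring
  simp only [h2]
  rw [ev_sub, ev_sub, ev_mul_left, ev_const, h1]
  ring

lemma norm_ev_div_mul_ex_sub_le (hF : IsComponentAdditive F) (hp0 : 0 ≤ p) (hp1 : p ≤ 1)
    (hM0 : 0 ≤ M)
    (hM : ∀ v : Fin n, ev p (fun G => ((hull G {v}).card : ℝ) ^ 2) ≤ M) (t : ℝ) (v : Fin n) :
    ‖ev p (fun G => ((F (restr G (hull G {v})) / (hull G {v}).card : ℝ) : ℂ) * ex t (F G))
        - ev p (fun G => ex t (F G)) *
          (((ev p (fun G => F (restr G (hull G {v})) / (hull G {v}).card) : ℝ) : ℂ)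
            + Complex.I * t * (varTerm p F v : ℝ))‖
      ≤ M * (2 + 12 * M + 4 * M ^ 2) * t ^ 2 := by
  set ψ := ev p (fun G => ex t (F G)) with hψ
  have h1 : ev p (fun G => ((F (restr G (hull G {v})) / (hull G {v}).card : ℝ) : ℂ) * ex t (F G))
      = ev p fun G => ((F (restr G (hull G {v})) / (hull G {v}).card : ℝ) : ℂ) *
          (ex t (F (restr G (hull G {v}))) *
            ev p fun G' => ex t (F (restr G' (hull G {v})ᶜ))) := by
    have := ev_hull_resample (p := p) {v} fun T H H' =>
      ((F H / T.card : ℝ) : ℂ) * (ex t (F H) * ex t (F H'))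
    simp only [ev_mul_left] at this
    rw [← this]
    congr 1
    ext G
    rw [← ex_add, ← hF.add_compl G _ (isClosedIn_hull G {v})]
  rw [h1, varTerm, ← ev_ofReal, ← ev_ofReal, ← ev_mul_left, ← ev_add, ← ev_mul_left, ← ev_sub]
  calc _ ≤ ev p fun G => (2 + 12 * M + 4 * M ^ 2) * t ^ 2 * ((hull G {v}).card : ℝ) ^ 2 := by
        refine norm_ev_le hp0 hp1 fun G => ?_
        set T := hull G {v} with hT
        set B := ev p fun G' => ex t (F (restr G' Tᶜ)) with hB
        set d : ℝ := ev p fun G' => F G' - F (restr G' Tᶜ) with hd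
        set a := F (restr G T) with ha
        have haT : |a| ≤ T.card := hF.abs_restr_le G T
        have hB1 := hF.norm_ev_ex_restr_sub_expansion_le hp0 hp1 hM0 hM t T
        rw [← hB, ← hψ, ← hd] at hB1
        have hdT : |d| ≤ 2 * M * T.card := by
          calc |d| ≤ ev p fun G' => 2 * ((hull G' T).card : ℝ) := by
                rw [← Real.norm_eq_abs]
                exact norm_ev_le hp0 hp1 fun G' => hF.abs_sub_restr_compl_le G' T
            _ ≤ 2 * (M * T.card) := by
                rw [ev_mul_left]
                exact mul_le_mul_of_nonneg_left (ev_card_hull_le hp0 hp1 hM T) zero_le_two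
            _ = _ := by ring
        have hψ1 : ‖ψ‖ ≤ 1 := by
          refine (norm_ev_le hp0 hp1 (g := fun _ => 1) fun G => (norm_ex _ _).le).trans_eq ?_
          simp
        have hg : |a / T.card| ≤ 1 := by
          rw [abs_div, Nat.abs_cast]
          exact div_le_one_of_le₀ haT (by positivity)
        have he1 : ‖ex t a - 1‖ ≤ |t| * T.card :=
          (norm_ex_sub_one_le t a).trans (by gcongr)
        have he2 : ‖ex t a - 1 - Complex.I * t * a‖ ≤ 2 * (t ^ 2 * (T.card : ℝ) ^ 2) := by
          refine (norm_ex_sub_one_sub_le t a).trans ?_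
          have := pow_le_pow_left₀ (abs_nonneg a) haT 2
          rw [sq_abs] at this
          gcongr
        have hsplit : ((a / T.card : ℝ) : ℂ) * (ex t a * B)
            - ψ * (((a / T.card : ℝ) : ℂ)
              + Complex.I * t * ((a / T.card * (a - d) : ℝ) : ℂ))
            = ((a / T.card : ℝ) : ℂ) * (ex t a * (B - ψ * (1 - Complex.I * t * (d : ℝ)))
              + ψ * ((ex t a - 1 - Complex.I * t * a)
                - Complex.I * t * (d : ℝ) * (ex t a - 1))) := by
          push_cast; ring
        rw [hsplit, norm_mul, Complex.norm_real, Real.norm_eq_abs]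
        calc _ ≤ 1 * ((10 * M + 4 * M ^ 2) * (t ^ 2 * (T.card : ℝ) ^ 2)
              + 1 * (2 * (t ^ 2 * (T.card : ℝ) ^ 2)
                + |t| * (2 * M * T.card) * (|t| * T.card))) := by
              refine mul_le_mul hg ?_ (norm_nonneg _) zero_le_one
              refine (norm_add_le _ _).trans (add_le_add ?_ ?_)
              · rwa [norm_mul, norm_ex, one_mul]
              · rw [norm_mul]
                refine mul_le_mul hψ1 ?_ (norm_nonneg _) zero_le_one
                refine (norm_sub_le _ _).trans (add_le_add he2 ?_)
                rw [norm_mul, norm_mul, norm_mul, Complex.norm_I, one_mul, Complex.norm_real,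
                  Complex.norm_real, Real.norm_eq_abs, Real.norm_eq_abs]
                gcongr
          _ = (12 * M + 4 * M ^ 2 - 2 * M + 2) * (t ^ 2 * (T.card : ℝ) ^ 2)
              + 2 * M * (|t| ^ 2 * (T.card : ℝ) ^ 2) := by ring
          _ = _ := by rw [sq_abs]; ring
    _ ≤ (2 + 12 * M + 4 * M ^ 2) * t ^ 2 * M := by
        rw [ev_mul_left]
        exact mul_le_mul_of_nonneg_left (hM v) (by positivity)
    _ = _ := by ring

/-- The characteristic function almost satisfies the Gaussian differential equation. -/
lemma norm_ev_centered_mul_ex_sub_le (hF : IsComponentAdditive F) (hp0 : 0 ≤ p) (hp1 : p ≤ 1)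
    (hM0 : 0 ≤ M)
    (hM : ∀ v : Fin n, ev p (fun G => ((hull G {v}).card : ℝ) ^ 2) ≤ M) (t : ℝ) :
    ‖ev p (fun G => ((F G - ev p F : ℝ) : ℂ) * ex t (F G - ev p F))
        - Complex.I * t * (ev p (fun G => (F G - ev p F) ^ 2) : ℝ)
          * ev p (fun G => ex t (F G - ev p F))‖
      ≤ M * (2 + 12 * M + 4 * M ^ 2) * n * t ^ 2 := by
  set μ := ev p F with hμ
  set ψ := ev p (fun G => ex t (F G)) with hψ
  have hμsum : μ = ∑ v, ev p (fun G => F (restr G (hull G {v})) / (hull G {v}).card) := by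
    rw [← ev_sum, hμ]
    congr 1
    ext G
    exact hF.eq_sum_div G
  have hshift : ∀ y, ex t (y - μ) = ex t (-μ) * ex t y := fun y => by
    rw [← ex_add]; congr 1; ring
  have h1 : ev p (fun G => (F G : ℂ) * ex t (F G)) = ∑ v, ev p (fun G =>
      ((F (restr G (hull G {v})) / (hull G {v}).card : ℝ) : ℂ) * ex t (F G)) := by
    rw [← ev_sum]
    congr 1
    ext G
    rw [← Finset.sum_mul, ← Complex.ofReal_sum, ← hF.eq_sum_div G]
  have h2 : ev p (fun G => ((F G - μ : ℝ) : ℂ) * ex t (F G - μ))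
      - Complex.I * t * (ev p (fun G => (F G - μ) ^ 2) : ℝ) * ev p (fun G => ex t (F G - μ))
      = ex t (-μ) * ∑ v, (ev p (fun G =>
          ((F (restr G (hull G {v})) / (hull G {v}).card : ℝ) : ℂ) * ex t (F G))
        - ψ * (((ev p (fun G => F (restr G (hull G {v})) / (hull G {v}).card) : ℝ) : ℂ)
            + Complex.I * t * (varTerm p F v : ℝ))) := by
    have h3 : ∀ G, ((F G - μ : ℝ) : ℂ) * ex t (F G - μ)
        = ex t (-μ) * ((F G : ℂ) * ex t (F G) - μ * ex t (F G)) := fun G => by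
      rw [hshift]; push_cast; ring
    have h4 : ev p (fun G => ex t (F G - μ)) = ex t (-μ) * ψ := by
      rw [hψ, ← ev_mul_left]
      simp only [hshift]
    simp only [h3]
    rw [h4, ev_mul_left, ev_sub, ev_mul_left, h1, hF.ev_sq_eq, Finset.sum_sub_distrib,
      ← Finset.mul_sum, Finset.sum_add_distrib, ← Complex.ofReal_sum, ← hμsum, ← Finset.mul_sum,
      ← Complex.ofReal_sum]
    ring
  rw [h2, norm_mul, norm_ex, one_mul]
  refine (norm_sum_le_of_le _ fun v _ =>
    hF.norm_ev_div_mul_ex_sub_le hp0 hp1 hM0 hM t v).trans_eq ?_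
  rw [Finset.sum_const, Finset.card_univ, Fintype.card_fin, nsmul_eq_mul]
  ring

end IsComponentAdditive

end Stein

/-! ### Comparison of the characteristic function with the Gaussian one -/

theorem hasDerivAt_ex (y t : ℝ) : HasDerivAt (fun t => ex t y) (Complex.I * y * ex t y) t := by
  have h : HasDerivAt (fun t : ℝ => Complex.I * ((t * y : ℝ) : ℂ))
      (Complex.I * ((1 * y : ℝ) : ℂ)) t :=
    (((hasDerivAt_id t).mul_const y).ofReal_comp).const_mul Complex.I
  refine h.cexp.congr_deriv ?_
  rw [one_mul, ex, mul_comm]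

theorem hasDerivAt_ev_ex {n : ℕ} {p : ℝ} (X : SimpleGraph (Fin n) → ℝ) (t : ℝ) :
    HasDerivAt (fun t => ev p fun G => ex t (X G))
      (Complex.I * ev p fun G => (X G : ℂ) * ex t (X G)) t := by
  rw [← ev_mul_left]
  simp only [ev]
  refine HasDerivAt.fun_sum fun G _ => ?_
  rw [← mul_assoc]
  exact (hasDerivAt_ex (X G) t).const_smul (erWeight n p G)

/-- An approximate Stein equation for `X` bounds the distance of its characteristic function
to that of a centered Gaussian of variance `s`. -/
theorem norm_ev_ex_sub_exp_le {n : ℕ} {p s L : ℝ} (X : SimpleGraph (Fin n) → ℝ) (hs : 0 ≤ s)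
    (hL : 0 ≤ L)
    (h : ∀ t : ℝ, ‖ev p (fun G => (X G : ℂ) * ex t (X G))
      - Complex.I * t * s * ev p (fun G => ex t (X G))‖ ≤ L * t ^ 2) (t : ℝ) :
    ‖ev p (fun G => ex t (X G)) - Complex.exp ((-(s * t ^ 2 / 2) : ℝ) : ℂ)‖ ≤ L * |t| ^ 3 := by
  set φ : ℝ → ℂ := fun t => ev p fun G => ex t (X G) with hφ
  set e : ℝ → ℂ := fun t => Complex.exp ((s * t ^ 2 / 2 : ℝ) : ℂ) with he
  have hnorm : ∀ τ, ‖e τ‖ = Real.exp (s * τ ^ 2 / 2) := fun τ => Complex.norm_exp_ofReal _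
  have hderiv : ∀ τ, HasDerivAt (fun τ => φ τ * e τ)
      (Complex.I * (ev p (fun G => (X G : ℂ) * ex τ (X G)) - Complex.I * τ * s * φ τ) * e τ) τ := by
    intro τ
    have h1 : HasDerivAt (fun τ : ℝ => s * τ ^ 2 / 2) (s * τ) τ := by
      refine (((hasDerivAt_pow 2 τ).const_mul s).div_const 2).congr_deriv ?_
      norm_num; ring
    refine ((hasDerivAt_ev_ex X τ).mul h1.ofReal_comp.cexp).congr_deriv ?_
    simp only [hφ, he]
    push_cast
    linear_combination (τ * s * ev p (fun G => ex τ (X G)) * Complex.exp (s * τ ^ 2 / 2)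
      : ℂ) * Complex.I_mul_I
  have hbound : ∀ τ ∈ Set.uIcc 0 t,
      ‖Complex.I * (ev p (fun G => (X G : ℂ) * ex τ (X G)) - Complex.I * τ * s * φ τ) * e τ‖
        ≤ L * t ^ 2 * Real.exp (s * t ^ 2 / 2) := by
    intro τ hτ
    have hτt : τ ^ 2 ≤ t ^ 2 := by
      refine sq_le_sq.2 ?_
      simpa using Set.abs_sub_left_of_mem_uIcc hτ
    rw [norm_mul, norm_mul, Complex.norm_I, one_mul, hnorm]
    refine mul_le_mul ((h τ).trans (mul_le_mul_of_nonneg_left hτt hL)) ?_ (Real.exp_pos _).le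
      (by positivity)
    exact Real.exp_le_exp.2 (by gcongr)
  have hmain := Convex.norm_image_sub_le_of_norm_hasDerivWithin_le
    (fun τ _ => (hderiv τ).hasDerivWithinAt) hbound (convex_uIcc 0 t) Set.left_mem_uIcc
    Set.right_mem_uIcc
  have h0 : φ 0 * e 0 = 1 := by simp [hφ, he, ex]
  have hinv : Complex.exp ((-(s * t ^ 2 / 2) : ℝ) : ℂ) * e t = 1 := by
    rw [he, ← Complex.exp_add]; simp
  have hkey : ‖φ t - Complex.exp ((-(s * t ^ 2 / 2) : ℝ) : ℂ)‖ * Real.exp (s * t ^ 2 / 2)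
      ≤ L * |t| ^ 3 * Real.exp (s * t ^ 2 / 2) := by
    rw [← hnorm, ← norm_mul, sub_mul, hinv, ← h0, hnorm]
    refine hmain.trans_eq ?_
    rw [sub_zero, Real.norm_eq_abs, ← sq_abs t]
    ring
  exact le_of_mul_le_mul_right hkey (Real.exp_pos _)

/-! ### A linear lower bound for the variance -/

section Variance

variable {n : ℕ} {p : ℝ}

/-- The indicator of the event that `u` and `v` are adjacent. -/
def adjInd (G : SimpleGraph (Fin n)) (u v : Fin n) : ℝ := if G.Adj u v then 1 else 0

/-- The indicator of the event that no edge leaves `{u, v}`. -/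
def isoInd (G : SimpleGraph (Fin n)) (u v : Fin n) : ℝ := if IsClosedIn G {u, v} then 1 else 0

lemma adjInd_mul_self (G : SimpleGraph (Fin n)) (u v : Fin n) :
    adjInd G u v * adjInd G u v = adjInd G u v := by
  simp [adjInd]

lemma adjInd_mix_of_mem {P : Set (Sym2 (Fin n))} {u v : Fin n} (h : s(u, v) ∈ P)
    (G G' : SimpleGraph (Fin n)) : adjInd (mix P G G') u v = adjInd G' u v := by
  simp [adjInd, mix_adj, h]

lemma adjInd_mix_of_notMem {P : Set (Sym2 (Fin n))} {u v : Fin n} (h : s(u, v) ∉ P)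
    (G G' : SimpleGraph (Fin n)) : adjInd (mix P G G') u v = adjInd G u v := by
  simp [adjInd, mix_adj, h]

lemma isoInd_mix {P : Set (Sym2 (Fin n))} {u v : Fin n}
    (h : ∀ a ∈ ({u, v} : Finset (Fin n)), ∀ b, s(a, b) ∈ P → b ∈ ({u, v} : Finset (Fin n)))
    (G G' : SimpleGraph (Fin n)) : isoInd (mix P G G') u v = isoInd G u v := by
  have : IsClosedIn (mix P G G') {u, v} ↔ IsClosedIn G {u, v} := by
    refine forall₂_congr fun a ha => forall_congr' fun b => ?_
    rw [mix_adj]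
    split_ifs with hP
    · simp only [h a ha b hP, implies_true]
    · rfl
  simp only [isoInd, this]

lemma isoInd_mix_singleton_self (u v : Fin n) (G G' : SimpleGraph (Fin n)) :
    isoInd (mix {s(u, v)} G G') u v = isoInd G u v := by
  refine isoInd_mix (fun a _ b hb => ?_) G G'
  have hb' : b ∈ s(u, v) := by
    rw [← Set.mem_singleton_iff.1 hb]; exact Sym2.mem_mk_right a b
  simpa using hb'

lemma isoInd_mix_singleton_of_disjoint {u v a b : Fin n}
    (h : Disjoint ({u, v} : Finset (Fin n)) {a, b}) (G G' : SimpleGraph (Fin n)) :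
    isoInd (mix {s(u, v)} G G') a b = isoInd G a b := by
  refine isoInd_mix (fun x hx y hy => ?_) G G'
  have hx' : x ∈ s(u, v) := by
    rw [← Set.mem_singleton_iff.1 hy]; exact Sym2.mem_mk_left x y
  exact absurd hx (Finset.disjoint_left.1 h (by simpa using hx'))

lemma ev_adjInd {u v : Fin n} (h : u ≠ v) : ev p (fun G => adjInd G u v) = p := by
  have h1 := ev_prod_edges (p := p) {s(u, v)} (by simpa using h) 0
  have h2 : ∀ G : SimpleGraph (Fin n), adjInd G u v
      = 1 - ∏ e ∈ {s(u, v)}, if e ∈ G.edgeSet then (0 : ℝ) else 1 := by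
    intro G
    by_cases hG : G.Adj u v <;> simp [adjInd, hG]
  simp only [h2]
  rw [ev_sub, ev_const, h1]
  simp

lemma le_ev_isoInd (hp0 : 0 ≤ p) (hp1 : p ≤ 1) (hnp : n * p ≤ 1) (u v : Fin n) :
    (1 - n * p) ^ 2 ≤ ev p (fun G => isoInd G u v) := by
  set S : Finset (Fin n) := {u, v} with hS
  set L : Finset (Sym2 (Fin n)) := (S ×ˢ Sᶜ).image fun x => s(x.1, x.2) with hL
  have hdiag : ∀ e ∈ L, ¬ e.IsDiag := by
    intro e he
    obtain ⟨x, hx, rfl⟩ := Finset.mem_image.1 he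
    rw [Finset.mem_product, Finset.mem_compl] at hx
    rw [Sym2.mk_isDiag_iff]
    intro h
    exact hx.2 (h ▸ hx.1)
  have hiso : ∀ G : SimpleGraph (Fin n), isoInd G u v
      = ∏ e ∈ L, if e ∈ G.edgeSet then (0 : ℝ) else 1 := by
    intro G
    rw [isoInd]
    split_ifs with h
    · refine (Finset.prod_eq_one fun e he => ?_).symm
      obtain ⟨x, hx, rfl⟩ := Finset.mem_image.1 he
      rw [Finset.mem_product, Finset.mem_compl] at hx
      exact if_neg fun hG => hx.2 (h _ hx.1 _ hG)
    · simp only [IsClosedIn, not_forall] at h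
      obtain ⟨a, ha, b, hab, hb⟩ := h
      have hmem : s(a, b) ∈ L :=
        Finset.mem_image.2 ⟨(a, b), Finset.mk_mem_product ha (Finset.mem_compl.2 hb), rfl⟩
      exact (Finset.prod_eq_zero hmem (by exact if_pos hab)).symm
  have hcard : L.card ≤ n * 2 := by
    calc L.card ≤ S.card * Sᶜ.card := Finset.card_image_le.trans_eq (Finset.card_product _ _)
      _ ≤ 2 * n := Nat.mul_le_mul Finset.card_le_two ((Finset.card_le_univ _).trans_eq (by simp))
      _ = n * 2 := mul_comm _ _
  simp only [hiso]
  rw [ev_prod_edges L hdiag]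
  calc (1 - n * p) ^ 2 ≤ ((1 - p) ^ n) ^ 2 := by
        refine pow_le_pow_left₀ (by linarith) ?_ 2
        have := one_add_mul_le_pow (a := -p) (by linarith) n
        simpa [sub_eq_add_neg] using this
    _ = (1 - p) ^ (n * 2) := (pow_mul _ _ _).symm
    _ ≤ (1 - p) ^ L.card := pow_le_pow_of_le_one (by linarith) (by linarith) hcard
    _ = _ := by ring

/-- A centered statistic of a single pair of vertices, correlated with the deficit. -/
def pairTerm (p : ℝ) (G : SimpleGraph (Fin n)) (q : Fin n × Fin n) : ℝ :=
  isoInd G q.1 q.2 * (p - adjInd G q.1 q.2)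

lemma ev_mul_sub_adjInd {u v : Fin n} (h : u ≠ v) (f : SimpleGraph (Fin n) → ℝ)
    (hf : ∀ G G', f (mix {s(u, v)} G G') = f G) :
    ev p (fun G => f G * (p - adjInd G u v)) = 0 := by
  rw [ev_mul_of_indep {s(u, v)} f (fun G => p - adjInd G u v) hf
    (fun G G' => by rw [adjInd_mix_of_mem (Set.mem_singleton _)])]
  rw [ev_sub, ev_const, ev_adjInd h, sub_self, mul_zero]

lemma ev_pairTerm {q : Fin n × Fin n} (hq : q.1 ≠ q.2) : ev p (fun G => pairTerm p G q) = 0 :=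
  ev_mul_sub_adjInd hq (fun G => isoInd G q.1 q.2) (isoInd_mix_singleton_self _ _)

lemma ev_deficit_mul_pairTerm {q : Fin n × Fin n} (hq : q.1 ≠ q.2) :
    ev p (fun G => deficit G * pairTerm p G q)
      = p * (1 - p) * ev p (fun G => isoInd G q.1 q.2) := by
  obtain ⟨u, v⟩ := q
  set S : Finset (Fin n) := {u, v} with hS
  have hsplit : ∀ G : SimpleGraph (Fin n), deficit G * pairTerm p G (u, v)
      = isoInd G u v * deficit (restr G Sᶜ) * (p - adjInd G u v)
        + -(1 - p) * (isoInd G u v * (p - adjInd G u v)) + p * (1 - p) * isoInd G u v := by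
    intro G
    by_cases h : IsClosedIn G {u, v}
    · have hadd := isComponentAdditive_deficit.add_compl G {u, v} h
      rw [deficit_restr_pair] at hadd
      have ha : (if G.Adj u v then (-1 : ℝ) else 0) = - adjInd G u v := by
        simp only [adjInd]; split_ifs <;> simp
      rw [hadd, ha]
      simp only [pairTerm, isoInd, if_pos h]
      linear_combination adjInd_mul_self G u v
    · simp [pairTerm, isoInd, h]
  simp only [hsplit]
  rw [ev_add, ev_add, ev_mul_left, ev_mul_left, ev_mul_sub_adjInd hq, ev_mul_sub_adjInd hq]
  · ring
  · exact isoInd_mix_singleton_self u v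
  · intro G G'
    rw [isoInd_mix_singleton_self]
    congr 2
    ext a b
    simp only [restr_adj, mix_adj, Set.mem_singleton_iff]
    refine and_congr_left fun hab => ?_
    rw [if_neg]
    intro he
    have ha : a ∈ s(u, v) := he ▸ Sym2.mem_mk_left a b
    exact Finset.mem_compl.1 hab.1 (by simpa [hS] using ha)

lemma abs_isoInd_le_one (G : SimpleGraph (Fin n)) (u v : Fin n) : |isoInd G u v| ≤ 1 := by
  simp only [isoInd]; split_ifs <;> simp

lemma ev_sub_adjInd_sq {u v : Fin n} (h : u ≠ v) :
    ev p (fun G => (p - adjInd G u v) ^ 2) = p * (1 - p) := by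
  have : ∀ G, (p - adjInd G u v) ^ 2 = p ^ 2 + (1 - 2 * p) * adjInd G u v := fun G => by
    linear_combination adjInd_mul_self G u v
  simp only [this]
  rw [ev_add, ev_const, ev_mul_left, ev_adjInd h]
  ring

lemma isoInd_mul_adjInd_eq_zero {G : SimpleGraph (Fin n)} {u v a b : Fin n}
    (ha : a ∈ ({u, v} : Finset (Fin n))) (hb : b ∉ ({u, v} : Finset (Fin n))) :
    isoInd G u v * adjInd G a b = 0 := by
  simp only [isoInd, adjInd]
  split_ifs with h h'
  · exact absurd (h a ha b h') hb
  all_goals simp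

lemma pairTerm_swap (G : SimpleGraph (Fin n)) (u v : Fin n) :
    pairTerm p G (v, u) = pairTerm p G (u, v) := by
  simp only [pairTerm, isoInd, adjInd, Finset.pair_comm v u, G.adj_comm v u]

lemma pairTerm_mul_self_le (G : SimpleGraph (Fin n)) (q : Fin n × Fin n) :
    pairTerm p G q * pairTerm p G q ≤ (p - adjInd G q.1 q.2) ^ 2 := by
  rw [← sq, pairTerm, mul_pow]
  exact mul_le_of_le_one_left (sq_nonneg _)
    ((sq_le_one_iff_abs_le_one _).2 (abs_isoInd_le_one _ _ _))

lemma pairTerm_mul_le_of_ne (G : SimpleGraph (Fin n)) {u v w : Fin n} (huv : u ≠ v) (huw : u ≠ w)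
    (hvw : v ≠ w) : pairTerm p G (u, v) * pairTerm p G (u, w) ≤ p ^ 2 := by
  have h1 : isoInd G u w * adjInd G u v = 0 :=
    isoInd_mul_adjInd_eq_zero (by simp) (by simp [huv.symm, hvw])
  have h2 : isoInd G u v * adjInd G u w = 0 :=
    isoInd_mul_adjInd_eq_zero (by simp) (by simp [huw.symm, hvw.symm])
  have h3 : pairTerm p G (u, v) * pairTerm p G (u, w)
      = isoInd G u v * isoInd G u w * p ^ 2 := by
    simp only [pairTerm]
    linear_combination (-isoInd G u v * (p - adjInd G u w)) * h1 - isoInd G u w * p * h2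
  rw [h3]
  refine mul_le_of_le_one_left (sq_nonneg p) ((le_abs_self _).trans ?_)
  rw [abs_mul]
  exact mul_le_one₀ (abs_isoInd_le_one _ _ _) (abs_nonneg _) (abs_isoInd_le_one _ _ _)

lemma ev_pairTerm_mul_of_disjoint {q r : Fin n × Fin n} (hq : q.1 ≠ q.2)
    (h : Disjoint ({q.1, q.2} : Finset (Fin n)) {r.1, r.2}) :
    ev p (fun G => pairTerm p G q * pairTerm p G r) = 0 := by
  have h1 : ∀ G : SimpleGraph (Fin n), pairTerm p G q * pairTerm p G r
      = isoInd G q.1 q.2 * pairTerm p G r * (p - adjInd G q.1 q.2) := fun G => by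
    simp only [pairTerm]; ring
  have hne : s(r.1, r.2) ∉ ({s(q.1, q.2)} : Set (Sym2 (Fin n))) := fun he => by
    have hmem : r.1 ∈ s(q.1, q.2) := by
      rw [← Set.mem_singleton_iff.1 he]; exact Sym2.mem_mk_left _ _
    exact Finset.disjoint_left.1 h (by simpa using hmem) (Finset.mem_insert_self _ _)
  simp only [h1]
  refine ev_mul_sub_adjInd hq _ fun G G' => ?_
  rw [pairTerm, pairTerm, isoInd_mix_singleton_self, isoInd_mix_singleton_of_disjoint h,
    adjInd_mix_of_notMem hne]

lemma ev_pairTerm_mul_le (hp0 : 0 ≤ p) (hp1 : p ≤ 1) {q r : Fin n × Fin n} (hq : q.1 ≠ q.2)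
    (hr : r.1 ≠ r.2) :
    ev p (fun G => pairTerm p G q * pairTerm p G r)
      ≤ p * ((if q = r then 1 else 0) + if q = r.swap then 1 else 0)
        + p ^ 2 * ((if q.1 = r.1 then 1 else 0) + (if q.1 = r.2 then 1 else 0)
          + (if q.2 = r.1 then 1 else 0) + if q.2 = r.2 then 1 else 0) := by
  have hsame : ev p (fun G => pairTerm p G q * pairTerm p G q) ≤ p := by
    refine (ev_mono hp0 hp1 fun G => pairTerm_mul_self_le G q).trans ?_
    rw [ev_sub_adjInd_sq hq]
    exact mul_le_of_le_one_right hp0 (by linarith)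
  have hconst : ∀ f : SimpleGraph (Fin n) → ℝ, (∀ G, f G ≤ p ^ 2) → ev p f ≤ p ^ 2 :=
    fun f hf => (ev_mono hp0 hp1 hf).trans_eq (ev_const _)
  have hp2 := sq_nonneg p
  obtain ⟨u, v⟩ := q
  obtain ⟨a, b⟩ := r
  simp only [Prod.swap_prod_mk, Prod.mk.injEq] at *
  by_cases hua : u = a
  · subst hua
    by_cases hvb : v = b
    · subst hvb
      split_ifs <;> first | linarith | tauto
    · have := hconst _ fun G => pairTerm_mul_le_of_ne G hq hr hvb
      split_ifs <;> first | linarith | tauto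
  by_cases hub : u = b
  · subst hub
    simp only [pairTerm_swap _ u a]
    by_cases hva : v = a
    · subst hva
      split_ifs <;> first | linarith | tauto
    · have := hconst _ fun G => pairTerm_mul_le_of_ne G hq hr.symm hva
      split_ifs <;> linarith
  by_cases hva : v = a
  · subst hva
    simp only [pairTerm_swap _ v u]
    have := hconst _ fun G => pairTerm_mul_le_of_ne G hq.symm hr hub
    split_ifs <;> linarith
  by_cases hvb : v = b
  · subst hvb
    simp only [pairTerm_swap _ v u, pairTerm_swap _ v a]
    have := hconst _ fun G => pairTerm_mul_le_of_ne G hq.symm hr.symm hua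
    split_ifs <;> linarith
  rw [ev_pairTerm_mul_of_disjoint hq (by simp [hua, hub, hva, hvb, eq_comm])]
  split_ifs <;> linarith

/-- The sum of `pairTerm` over all ordered pairs of distinct vertices. -/
def pairSum (p : ℝ) (G : SimpleGraph (Fin n)) : ℝ :=
  ∑ q ∈ (Finset.univ : Finset (Fin n)).offDiag, pairTerm p G q

lemma ev_pairSum_sq_le (hp0 : 0 ≤ p) (hp1 : p ≤ 1) :
    ev p (fun G : SimpleGraph (Fin n) => pairSum p G ^ 2) ≤ 2 * n ^ 2 * p + 4 * n ^ 3 * p ^ 2 := by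
  set B : Fin n × Fin n → Fin n × Fin n → ℝ := fun q r =>
    p * ((if q = r then 1 else 0) + if q = r.swap then 1 else 0)
        + p ^ 2 * ((if q.1 = r.1 then 1 else 0) + (if q.1 = r.2 then 1 else 0)
          + (if q.2 = r.1 then 1 else 0) + if q.2 = r.2 then 1 else 0) with hB
  have hB0 : ∀ q r, 0 ≤ B q r := fun q r => by
    have hind : ∀ (P : Prop) [Decidable P], (0 : ℝ) ≤ if P then 1 else 0 := fun P => by
      split_ifs <;> simp
    have hp2 := sq_nonneg p
    refine add_nonneg (mul_nonneg hp0 (add_nonneg (hind _) (hind _))) (mul_nonneg hp2 ?_)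
    exact add_nonneg (add_nonneg (add_nonneg (hind _) (hind _)) (hind _)) (hind _)
  simp only [pairSum, sq, Finset.sum_mul_sum]
  rw [ev_sum]
  calc _ ≤ ∑ q ∈ (Finset.univ : Finset (Fin n)).offDiag,
        ∑ r ∈ (Finset.univ : Finset (Fin n)).offDiag, B q r := by
        refine Finset.sum_le_sum fun q hq => ?_
        rw [ev_sum]
        refine Finset.sum_le_sum fun r hr => ?_
        exact ev_pairTerm_mul_le hp0 hp1 (Finset.mem_offDiag.1 hq).2.2 (Finset.mem_offDiag.1 hr).2.2
    _ ≤ ∑ q, ∑ r, B q r := by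
        refine (Finset.sum_le_sum fun q _ => ?_).trans
          (Finset.sum_le_univ_sum_of_nonneg fun q => Finset.sum_nonneg fun r _ => hB0 q r)
        exact Finset.sum_le_univ_sum_of_nonneg fun r => hB0 q r
    _ = _ := by
        have hswap : ∀ q r : Fin n × Fin n, q = r.swap ↔ q.swap = r := fun q r =>
          ⟨fun h => by rw [h, Prod.swap_swap], fun h => by rw [← h, Prod.swap_swap]⟩
        have hfst : ∀ a : Fin n, ∑ r : Fin n × Fin n, (if a = r.1 then (1 : ℝ) else 0) = n :=
          fun a => by rw [Fintype.sum_prod_type_right]; simp [-Finset.sum_boole]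
        have hsnd : ∀ a : Fin n, ∑ r : Fin n × Fin n, (if a = r.2 then (1 : ℝ) else 0) = n :=
          fun a => by rw [Fintype.sum_prod_type]; simp [-Finset.sum_boole]
        simp only [hB, hswap, Finset.sum_add_distrib, ← Finset.mul_sum, hfst, hsnd]
        simp
        ring

/-- In the subcritical regime, the variance of the deficit grows at least linearly. -/
lemma exists_le_ev_deficit_sq {c : ℝ} (hc0 : 0 < c) (hc1 : c < 1) :
    ∃ κ : ℝ, 0 < κ ∧ ∀ n : ℕ, 2 ≤ n → κ * n ≤ ev (n := n) (c / n)
      (fun G => (deficit G - ev (n := n) (c / n) deficit) ^ 2) := by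
  have h1c : 0 < 1 - c := by linarith
  set κ : ℝ := c * (1 - c) ^ 3 / 2 with hκ
  set b : ℝ := 2 * c + 4 * c ^ 2 with hb
  have hκ0 : 0 < κ := by positivity
  have hb0 : 0 < b := by positivity
  refine ⟨κ ^ 2 / b, by positivity, fun n hn => ?_⟩
  have hn2 : (2 : ℝ) ≤ n := by exact_mod_cast hn
  have hn0 : (0 : ℝ) < n := by linarith
  set p : ℝ := c / n with hp
  have hnp : n * p = c := by rw [hp]; field_simp
  have hp0 : 0 ≤ p := by positivity
  have hpc : p ≤ c := by rw [hp]; exact div_le_self hc0.le (by linarith)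
  have hp1 : p ≤ 1 := by linarith
  set μ : ℝ := ev (n := n) p deficit with hμ
  have hcross : κ * n ≤ ev (n := n) p (fun G => (deficit G - μ) * pairSum p G) := by
    simp only [pairSum, Finset.mul_sum]
    rw [ev_sum]
    calc κ * n ≤ ∑ _q ∈ (Finset.univ : Finset (Fin n)).offDiag, p * (1 - c) ^ 3 := by
          rw [Finset.sum_const, Finset.offDiag_card, Finset.card_fin, nsmul_eq_mul,
            Nat.cast_sub (Nat.le_mul_self n)]
          have : ((n * n : ℕ) - (n : ℝ)) * (p * (1 - c) ^ 3) = (n - 1) * (c * (1 - c) ^ 3) := by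
            rw [← hnp]; push_cast; ring
          rw [this, hκ]
          have h3 : 0 ≤ c * (1 - c) ^ 3 := by positivity
          nlinarith
      _ ≤ _ := by
          refine Finset.sum_le_sum fun q hq => ?_
          have hne := (Finset.mem_offDiag.1 hq).2.2
          simp only [sub_mul]
          rw [ev_sub, ev_mul_left, ev_pairTerm hne, mul_zero, sub_zero,
            ev_deficit_mul_pairTerm hne, mul_assoc]
          refine mul_le_mul_of_nonneg_left ?_ hp0
          have hiso := le_ev_isoInd hp0 hp1 (hnp.trans_le hc1.le) q.1 q.2
          rw [hnp] at hiso
          rw [pow_succ']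
          exact mul_le_mul (by linarith) hiso (by positivity) (by linarith)
  have hsq : ev (n := n) p (fun G => pairSum p G ^ 2) ≤ b * n := by
    refine (ev_pairSum_sq_le hp0 hp1).trans_eq ?_
    rw [hb, ← hnp]; ring
  have hpos : 0 ≤ ev (n := n) p (fun G => (deficit G - μ - κ / b * pairSum p G) ^ 2) := by
    have := ev_mono (n := n) hp0 hp1 (f := fun _ => 0)
      (g := fun G => (deficit G - μ - κ / b * pairSum p G) ^ 2) fun G => sq_nonneg _
    rwa [ev_const] at this
  have hexp : ∀ G : SimpleGraph (Fin n), (deficit G - μ - κ / b * pairSum p G) ^ 2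
      = (deficit G - μ) ^ 2 - 2 * (κ / b) * ((deficit G - μ) * pairSum p G)
        + (κ / b) ^ 2 * pairSum p G ^ 2 := fun G => by ring
  simp only [hexp] at hpos
  rw [ev_add, ev_sub, ev_mul_left, ev_mul_left] at hpos
  have e1 := mul_le_mul_of_nonneg_left hcross (by positivity : 0 ≤ 2 * (κ / b))
  have e2 := mul_le_mul_of_nonneg_left hsq (sq_nonneg (κ / b))
  have e3 : 2 * (κ / b) * (κ * n) - (κ / b) ^ 2 * (b * n) = κ ^ 2 / b * n := by
    field_simp; ring
  linarith

end Variance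

/-! ### Convergence of the characteristic functions -/

section CharFun

variable {n : ℕ} {p : ℝ}

lemma ev_abs_le_sqrt (hp0 : 0 ≤ p) (hp1 : p ≤ 1) (X : SimpleGraph (Fin n) → ℝ) :
    ev p (fun G => |X G|) ≤ √(ev p fun G => X G ^ 2) := by
  set m := ev p fun G => |X G| with hm
  have h1 : 0 ≤ ev p fun G => (|X G| - m) ^ 2 := by
    simpa using ev_mono hp0 hp1 (f := fun _ => 0) fun G => sq_nonneg (|X G| - m)
  have h2 : ∀ G, (|X G| - m) ^ 2 = X G ^ 2 - 2 * m * |X G| + m ^ 2 := fun G => by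
    rw [← sq_abs (X G)]; ring
  simp only [h2] at h1
  rw [ev_add, ev_sub, ev_mul_left, ev_const, ← hm] at h1
  exact Real.le_sqrt_of_sq_le (by linarith)

lemma abs_ev_sq_sub_ev_sq_le (hp0 : 0 ≤ p) (hp1 : p ≤ 1) {X Y : SimpleGraph (Fin n) → ℝ}
    (h : ∀ G, |Y G - X G| ≤ 2) :
    |ev p (fun G => Y G ^ 2) - ev p (fun G => X G ^ 2)|
      ≤ 4 * √(ev p fun G => X G ^ 2) + 4 := by
  rw [← ev_sub, ← Real.norm_eq_abs]
  calc _ ≤ ev p fun G => 4 * |X G| + 4 := by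
        refine norm_ev_le hp0 hp1 fun G => ?_
        have h1 : Y G ^ 2 - X G ^ 2 = (Y G - X G) * (2 * X G + (Y G - X G)) := by ring
        have h2 : |2 * X G + (Y G - X G)| ≤ 2 * |X G| + 2 := by
          refine (abs_add_le _ _).trans (add_le_add ?_ (h G))
          rw [abs_mul, abs_two]
        rw [Real.norm_eq_abs, h1, abs_mul]
        calc _ ≤ 2 * (2 * |X G| + 2) :=
              mul_le_mul (h G) h2 (abs_nonneg _) zero_le_two
          _ = _ := by ring
    _ ≤ _ := by
        rw [ev_add, ev_mul_left, ev_const]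
        linarith [ev_abs_le_sqrt hp0 hp1 X]

lemma norm_ev_ex_sub_ev_ex_le (hp0 : 0 ≤ p) (hp1 : p ≤ 1) {X Y : SimpleGraph (Fin n) → ℝ}
    (h : ∀ G, |Y G - X G| ≤ 2) (t : ℝ) :
    ‖ev p (fun G => ex t (Y G)) - ev p (fun G => ex t (X G))‖ ≤ |t| * 2 := by
  rw [← ev_sub]
  refine (norm_ev_le hp0 hp1 (g := fun _ => |t| * 2) fun G => ?_).trans_eq (ev_const _)
  exact (norm_ex_sub_le t _ _).trans (mul_le_mul_of_nonneg_left (h G) (abs_nonneg t))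

lemma abs_centered_betaR_sub_centered_deficit_le (hp0 : 0 ≤ p) (hp1 : p ≤ 1) (hn : n ≠ 1)
    (G : SimpleGraph (Fin n)) :
    |betaR G - ev (n := n) p betaR - (deficit G - ev (n := n) p deficit)| ≤ 2 := by
  have h1 : |ev p (fun G : SimpleGraph (Fin n) => betaR G - (deficit G + n))| ≤ 1 := by
    rw [← Real.norm_eq_abs]
    exact (norm_ev_le hp0 hp1 (g := fun _ => 1) fun G => abs_betaR_sub_deficit_le hn G).trans_eq
      (ev_const _)
  have h2 := abs_betaR_sub_deficit_le hn G
  rw [ev_sub, ev_add, ev_const] at h1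
  rw [abs_le] at *
  constructor <;> linarith [h1.1, h1.2, h2.1, h2.2]

/-- A perturbation of order `√(s n)` of a variance `s n` that grows at least linearly. -/
lemma tendsto_div_of_abs_sub_le {s v : ℕ → ℝ} {κ : ℝ} (hκ : 0 < κ)
    (hs : ∀ᶠ n : ℕ in atTop, κ * n ≤ s n) (hv : ∀ᶠ n in atTop, |v n - s n| ≤ 4 * √(s n) + 4) :
    Tendsto (fun n => s n / v n) atTop (𝓝 1) ∧ Tendsto v atTop atTop := by
  have hs_top : Tendsto s atTop atTop :=
    tendsto_atTop_mono' _ hs (tendsto_natCast_atTop_atTop.const_mul_atTop hκ)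
  have hsqrt : Tendsto (fun n => (√(s n))⁻¹) atTop (𝓝 0) :=
    tendsto_inv_atTop_zero.comp (Real.tendsto_sqrt_atTop.comp hs_top)
  have hratio : Tendsto (fun n => v n / s n) atTop (𝓝 1) := by
    rw [tendsto_iff_norm_sub_tendsto_zero]
    have hbound : Tendsto (fun n => 4 * (√(s n))⁻¹ + 4 * (s n)⁻¹) atTop (𝓝 0) := by
      simpa using (hsqrt.const_mul 4).add ((tendsto_inv_atTop_zero.comp hs_top).const_mul 4)
    refine squeeze_zero' (Eventually.of_forall fun n => norm_nonneg _) ?_ hbound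
    filter_upwards [hv, hs_top.eventually_gt_atTop 0] with n hn hpos
    rw [div_sub_one hpos.ne', norm_div, Real.norm_eq_abs, Real.norm_of_nonneg hpos.le,
      div_le_iff₀ hpos]
    refine hn.trans_eq ?_
    have h1 : (√(s n))⁻¹ * s n = √(s n) := by
      rw [inv_mul_eq_div, Real.div_sqrt]
    rw [add_mul, mul_assoc, h1, mul_assoc, inv_mul_cancel₀ hpos.ne', mul_one]
  constructor
  · simpa using hratio.inv₀ one_ne_zero
  · refine (hs_top.atTop_mul_pos one_pos hratio).congr' ?_
    filter_upwards [hs_top.eventually_gt_atTop 0] with n hpos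
    exact mul_div_cancel₀ _ hpos.ne'

/-- The characteristic function of the normalized metric dimension converges to the standard
Gaussian one. -/
lemma tendsto_ev_ex_erNormβ {c : ℝ} (hc0 : 0 < c) (hc1 : c < 1) (t : ℝ) :
    Tendsto (fun n : ℕ => ev (n := n) (c / n) fun G => ex t (erNormβ n (c / n) G)) atTop
      (𝓝 (Complex.exp ((-(t ^ 2 / 2) : ℝ) : ℂ))) := by
  obtain ⟨M, hM0, hM⟩ := exists_ev_card_hull_sq_le hc0 hc1
  obtain ⟨κ, hκ, hvar⟩ := exists_le_ev_deficit_sq hc0 hc1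
  set K : ℝ := M * (2 + 12 * M + 4 * M ^ 2) with hK
  set X : ∀ n, SimpleGraph (Fin n) → ℝ := fun n G => deficit G - ev (n := n) (c / n) deficit
    with hX
  set Y : ∀ n, SimpleGraph (Fin n) → ℝ := fun n G => betaR G - ev (n := n) (c / n) betaR with hY
  set s : ℕ → ℝ := fun n => ev (n := n) (c / n) fun G => X n G ^ 2 with hs
  set v : ℕ → ℝ := fun n => ev (n := n) (c / n) fun G => Y n G ^ 2 with hv
  set r : ℕ → ℝ := fun n => (√(v n))⁻¹ with hr
  have hp0 : ∀ n : ℕ, 0 ≤ c / n := fun n => by positivity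
  have hp1 : ∀ n : ℕ, 2 ≤ n → c / n ≤ 1 := fun n hn =>
    (div_le_self hc0.le (by exact_mod_cast (by omega : 1 ≤ n))).trans hc1.le
  have hYX : ∀ n : ℕ, 2 ≤ n → ∀ G, |Y n G - X n G| ≤ 2 := fun n hn G =>
    abs_centered_betaR_sub_centered_deficit_le (hp0 n) (hp1 n hn) (by omega) G
  obtain ⟨hratio, hv_top⟩ := tendsto_div_of_abs_sub_le (s := s) (v := v) hκ
    ((eventually_ge_atTop 2).mono hvar)
    ((eventually_ge_atTop 2).mono fun n hn => abs_ev_sq_sub_ev_sq_le (hp0 n) (hp1 n hn) (hYX n hn))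
  have hr0 : Tendsto r atTop (𝓝 0) :=
    tendsto_inv_atTop_zero.comp (Real.tendsto_sqrt_atTop.comp hv_top)
  have hlimit : Tendsto (fun n => Complex.exp ((-(s n / v n * t ^ 2 / 2) : ℝ) : ℂ)) atTop
      (𝓝 (Complex.exp ((-(t ^ 2 / 2) : ℝ) : ℂ))) := by
    refine (Complex.continuous_exp.comp Complex.continuous_ofReal).continuousAt.tendsto.comp ?_
    simpa using (((hratio.mul_const (t ^ 2)).div_const 2).neg)
  have herror : Tendsto (fun n => |t| * 2 * r n + K * |t| ^ 3 * (2 / κ) * r n) atTop (𝓝 0) := by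
    simpa using (hr0.const_mul (|t| * 2)).add (hr0.const_mul (K * |t| ^ 3 * (2 / κ)))
  have hdiff : Tendsto (fun n : ℕ => (ev (n := n) (c / n) fun G => ex t (erNormβ n (c / n) G))
      - Complex.exp ((-(s n / v n * t ^ 2 / 2) : ℝ) : ℂ)) atTop (𝓝 0) := by
    refine squeeze_zero_norm' ?_ herror
    filter_upwards [eventually_ge_atTop 2, hv_top.eventually_gt_atTop 0,
      hratio.eventually_le_const one_lt_two] with n hn hvn hsv
    have hn0 : (0 : ℝ) < n := by exact_mod_cast (by omega : 0 < n)
    have hr_pos : 0 < r n := inv_pos.2 (Real.sqrt_pos.2 hvn)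
    have hr_sq : r n ^ 2 = (v n)⁻¹ := by rw [hr, inv_pow, Real.sq_sqrt hvn.le]
    have hK0 : 0 ≤ K := by positivity
    have hs0 : 0 ≤ s n := (by positivity : 0 ≤ κ * n).trans (hvar n hn)
    have hnorm : ∀ G, ex t (erNormβ n (c / n) G) = ex (t * r n) (Y n G) := fun G => by
      have h1 : erVar n (c / n) betaR = v n := by
        simp only [erVar, erExp_eq_ev, hv, hY]
      rw [erNormβ, h1, erExp_eq_ev, ex, ex]
      congr 3
      simp only [hr, hY]
      ring
    have hgauss : s n / v n * t ^ 2 / 2 = s n * (t * r n) ^ 2 / 2 := by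
      rw [mul_pow, hr_sq]; ring
    have habs : |t * r n| = |t| * r n := by rw [abs_mul, abs_of_pos hr_pos]
    have h1 := norm_ev_ex_sub_ev_ex_le (hp0 n) (hp1 n hn) (hYX n hn) (t * r n)
    have h2 := norm_ev_ex_sub_exp_le (p := c / n) (X n) hs0 (L := K * n) (by positivity)
      (fun τ => isComponentAdditive_deficit.norm_ev_centered_mul_ex_sub_le (hp0 n) (hp1 n hn) hM0
        (hM n _ (hp0 n) (hp1 n hn) (mul_div_cancel₀ _ hn0.ne').le) τ) (t * r n)
    have h3 : n * r n ^ 2 ≤ 2 / κ := by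
      rw [hr_sq, le_div_iff₀ hκ]
      calc n * (v n)⁻¹ * κ = κ * n * (v n)⁻¹ := by ring
        _ ≤ s n * (v n)⁻¹ := mul_le_mul_of_nonneg_right (hvar n hn) (inv_pos.2 hvn).le
        _ ≤ 2 := hsv
    simp only [hnorm]
    rw [hgauss]
    refine (norm_sub_le_norm_sub_add_norm_sub _ _ _).trans (add_le_add h1 h2) |>.trans ?_
    rw [habs]
    have h4 : K * n * (|t| * r n) ^ 3 = K * |t| ^ 3 * (n * r n ^ 2) * r n := by ring
    rw [h4]
    have h5 : K * |t| ^ 3 * (n * r n ^ 2) * r n ≤ K * |t| ^ 3 * (2 / κ) * r n := by gcongr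
    linarith
  simpa using hdiff.add hlimit

end CharFun

/-! ### Convergence in distribution -/

open MeasureTheory ProbabilityTheory

section Law

variable {n : ℕ} {p : ℝ}

/-- The law of a random variable `X` on the probability space `G(n,p)`. -/
def erLaw (p : ℝ) (X : SimpleGraph (Fin n) → ℝ) : Measure ℝ :=
  ∑ G, ENNReal.ofReal (erWeight n p G) • Measure.dirac (X G)

lemma erLaw_apply (hp0 : 0 ≤ p) (hp1 : p ≤ 1) (X : SimpleGraph (Fin n) → ℝ) {A : Set ℝ}
    (hA : MeasurableSet A) : erLaw p X A = ENNReal.ofReal (erPr n p {G | X G ∈ A}) := by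
  rw [erPr, finsum_mem_def, finsum_eq_sum_of_fintype, ENNReal.ofReal_sum_of_nonneg fun G _ =>
    Set.indicator_nonneg (fun G _ => erWeight_nonneg hp0 hp1 G) G]
  simp only [erLaw, Measure.coe_finsetSum, Finset.sum_apply, Measure.smul_apply, smul_eq_mul,
    Measure.dirac_apply' _ hA]
  refine Finset.sum_congr rfl fun G _ => ?_
  by_cases h : X G ∈ A <;> simp [h]

lemma isProbabilityMeasure_erLaw (hp0 : 0 ≤ p) (hp1 : p ≤ 1) (X : SimpleGraph (Fin n) → ℝ) :
    IsProbabilityMeasure (erLaw p X) := by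
  refine ⟨?_⟩
  rw [erLaw_apply hp0 hp1 X MeasurableSet.univ]
  simp [erPr, finsum_eq_sum_of_fintype, sum_erWeight]

lemma charFun_erLaw (hp0 : 0 ≤ p) (hp1 : p ≤ 1) (X : SimpleGraph (Fin n) → ℝ) (t : ℝ) :
    charFun (erLaw p X) t = ev p fun G => ex t (X G) := by
  rw [charFun_apply_real, erLaw, integral_finsetSum_measure]
  · simp only [ev, integral_smul_measure, integral_dirac,
      ENNReal.toReal_ofReal (erWeight_nonneg hp0 hp1 _), ex]
    refine Finset.sum_congr rfl fun G _ => ?_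
    push_cast
    ring_nf
  · intro G _
    exact (integrable_dirac (by simp)).smul_measure ENNReal.ofReal_ne_top

lemma gaussianReal_Iic (x : ℝ) :
    gaussianReal 0 1 (Set.Iic x) = ENNReal.ofReal (stdGaussianCDF x) := by
  rw [gaussianReal_apply_eq_integral 0 one_ne_zero, stdGaussianCDF, ← integral_const_mul]
  simp [gaussianPDFReal]

end Law

/-- for `G_n ∈ G(n, c/n)` with `0 < c < 1`, the normalized metric dimension
`(β(G_n) − E β(G_n))/sqrt(Var β(G_n))` converges in distribution to a standard normal
random variable (pointwise convergence of CDFs; the normal CDF is continuous). -/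
theorem er_metricDim_clt (c : ℝ) (hc0 : 0 < c) (hc1 : c < 1) :
    ∀ x : ℝ,
      Tendsto (fun n : ℕ => erPr n (c / n) {G | erNormβ n (c / n) G ≤ x})
        atTop (𝓝 (stdGaussianCDF x)) := by
  intro x
  have hp0 : ∀ n : ℕ, 0 ≤ c / n := fun n => by positivity
  have hp1 : ∀ n : ℕ, c / n ≤ 1 := fun n => by
    rcases n.eq_zero_or_pos with rfl | hn
    · simp
    · exact (div_le_self hc0.le (by exact_mod_cast hn)).trans hc1.le
  have hlaw : ∀ n : ℕ, IsProbabilityMeasure (erLaw (c / n) (erNormβ n (c / n))) := fun n =>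
    isProbabilityMeasure_erLaw (hp0 n) (hp1 n) _
  let ν : ℕ → ProbabilityMeasure ℝ := fun n => ⟨erLaw (c / n) (erNormβ n (c / n)), hlaw n⟩
  let γ : ProbabilityMeasure ℝ := ⟨gaussianReal 0 1, inferInstance⟩
  have hν : Tendsto ν atTop (𝓝 γ) := by
    refine ProbabilityMeasure.tendsto_iff_tendsto_charFun.2 fun t => ?_
    simp only [ν, γ, ProbabilityMeasure.coe_mk, charFun_gaussianReal,
      charFun_erLaw (hp0 _) (hp1 _)]
    convert tendsto_ev_ex_erNormβ hc0 hc1 t using 3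
    simp
  have hconv := ProbabilityMeasure.tendsto_measure_of_null_frontier_of_tendsto' hν
    (E := Set.Iic x) <| by
      have := nullSingletonClass_gaussianReal (μ := 0) (one_ne_zero (α := NNReal))
      simp [γ]
  have hnonneg : 0 ≤ stdGaussianCDF x :=
    mul_nonneg (by positivity) (integral_nonneg fun _ => (Real.exp_pos _).le)
  have hfin := (ENNReal.tendsto_toReal (measure_ne_top (γ : Measure ℝ) (Set.Iic x))).comp hconv
  simp only [ν, γ, ProbabilityMeasure.coe_mk, gaussianReal_Iic, Function.comp_def,
    erLaw_apply (hp0 _) (hp1 _) _ measurableSet_Iic, ENNReal.toReal_ofReal hnonneg] at hfin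
  refine hfin.congr fun n => ?_
  rw [ENNReal.toReal_ofReal]
  · rfl
  · exact finsum_nonneg fun G => finsum_nonneg fun _ => erWeight_nonneg (hp0 n) (hp1 n) G

end MetricDimPaper
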